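/- Let R(n) denote the number of isomorphism classes of vertex-rooted connected 3-leaf power simple graphs on n vertices, where a vertex-rooted graph is a pair (G, v) with v a vertex of G, and (G, v) and (G', v') are identified when there is a graph isomorphism from G to G' sending v to v'. There exist real constants c > 0, C > 0 and a natural number N such that for all n ≥ N, c · 3.848^n · n^(−3/2) ≤ R(n) ≤ C · 3.849^n · n^(−3/2). -/

import Mathlib

/-- A vertex of a simple graph is a leaf if it has exactly one neighbour. -/
def IsLeafVert {V : Type} (T : SimpleGraph V) (v : V) : Prop :=
  ∃! u, T.Adj v u

/-- A simple graph `G` is a 3-leaf power if there are a finite tree `T` and a bijection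
from the vertices of `G` onto the leaves of `T` such that two distinct vertices of `G`
are adjacent iff the corresponding leaves are at distance at most 3 in `T`. -/
def IsThreeLeafPower {V : Type} (G : SimpleGraph V) : Prop :=
  ∃ (m : ℕ) (T : SimpleGraph (Fin m)), T.IsTree ∧
    ∃ f : V → Fin m,
      Function.Injective f ∧
      (∀ v : V, IsLeafVert T (f v)) ∧
      (∀ w : Fin m, IsLeafVert T w → ∃ v : V, f v = w) ∧
      (∀ x y : V, x ≠ y → (G.Adj x y ↔ T.dist (f x) (f y) ≤ 3))

/-- The number of isomorphism classes of connected 3-leaf power simple graphs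
on `n` vertices. -/
noncomputable def numConn3LP (n : ℕ) : ℕ :=
  Nat.card (Quot (fun (G G' : {G : SimpleGraph (Fin n) // G.Connected ∧ IsThreeLeafPower G}) =>
    Nonempty (G.val ≃g G'.val)))

/-- The number of isomorphism classes of vertex-rooted connected 3-leaf power simple
graphs on `n` vertices: pairs `(G, v)` identified under isomorphisms sending root to
root. -/
noncomputable def numRootedConn3LP (n : ℕ) : ℕ :=
  Nat.card (Quot
    (fun (p q : {x : SimpleGraph (Fin n) × Fin n // x.1.Connected ∧ IsThreeLeafPower x.1}) =>
      ∃ φ : p.val.1 ≃g q.val.1, φ p.val.2 = q.val.2))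

open Finset in
/-- `M` is the Euler transform of `F` (the number of multisets of objects counted by `F`), and `F`
is the sequence of partial sums of `M`. -/
structure IsEulerPair (F M : ℕ → ℕ) : Prop where
  zero : M 0 = 1
  sum : ∀ n, F n = ∑ i ∈ range n, M i
  euler : ∀ n N, n ≤ N → n * M n =
    ∑ d ∈ Icc 1 N, ∑ j ∈ Icc 1 N, d * F d * (if d * j ≤ n then M (n - d * j) else 0)

namespace IsEulerPair

open Finset

variable {F M : ℕ → ℕ}

/-- The truncated generating function of `a`. -/
noncomputable def trunc (a : ℕ → ℕ) (N : ℕ) (x : ℝ) : ℝ := ∑ n ∈ range (N + 1), (a n : ℝ) * x ^ n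

/-- The truncated exponent in the Euler transform. -/
noncomputable def expo (F : ℕ → ℕ) (N : ℕ) (x : ℝ) : ℝ :=
  ∑ d ∈ Icc 1 N, ∑ j ∈ Icc 1 N, (F d : ℝ) * (x ^ (d * j) / j)

lemma F_zero (h : IsEulerPair F M) : F 0 = 0 := by simp [h.sum 0]

lemma F_succ (h : IsEulerPair F M) (n : ℕ) : F (n + 1) = F n + M n := by
  rw [h.sum, h.sum, sum_range_succ]

lemma trunc_eq_Icc (h : IsEulerPair F M) (N : ℕ) (x : ℝ) : trunc F N x = ∑ d ∈ Icc 1 N, (F d : ℝ) * x ^ d := by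
  unfold trunc
  rw [range_eq_Ico, sum_eq_sum_Ico_succ_bot (by omega), h.F_zero]
  simp only [Nat.cast_zero, zero_mul, zero_add]
  rfl

lemma mul_trunc (h : IsEulerPair F M) (N : ℕ) (x : ℝ) :
    x * trunc M N x = trunc F (N + 1) x - x * trunc F N x := by
  unfold trunc
  rw [sum_range_succ' (fun n => (F n : ℝ) * x ^ n) (N + 1), h.F_zero, mul_sum, mul_sum]
  simp only [Nat.cast_zero, zero_mul, add_zero]
  rw [← sum_sub_distrib]
  refine sum_congr rfl fun n _ => ?_
  rw [h.F_succ]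
  push_cast
  ring

lemma trunc_nonneg (a : ℕ → ℕ) (N : ℕ) {x : ℝ} (hx : 0 ≤ x) : 0 ≤ trunc a N x :=
  sum_nonneg fun _ _ => by positivity

lemma trunc_mono (a : ℕ → ℕ) {x : ℝ} (hx : 0 ≤ x) : Monotone fun N => trunc a N x := by
  intro N N' hN
  exact sum_le_sum_of_subset_of_nonneg (by simpa using hN) fun _ _ _ => by positivity

lemma deriv_bound (h : IsEulerPair F M) (N : ℕ) {y : ℝ} (hy : 0 ≤ y) :
    ∑ n ∈ range (N + 1), (M n : ℝ) * (n * y ^ n) ≤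
      (∑ d ∈ Icc 1 N, ∑ j ∈ Icc 1 N, (F d : ℝ) * (d * y ^ (d * j))) * trunc M N y := by
  have key : ∀ n ∈ range (N + 1), (M n : ℝ) * (n * y ^ n) =
      ∑ d ∈ Icc 1 N, ∑ j ∈ Icc 1 N, (F d : ℝ) * (d * y ^ (d * j)) *
        (if d * j ≤ n then (M (n - d * j) : ℝ) * y ^ (n - d * j) else 0) := by
    intro n hn
    have e := h.euler n N (by simpa [Nat.lt_succ_iff] using hn)
    have e' : (n : ℝ) * M n = ∑ d ∈ Icc 1 N, ∑ j ∈ Icc 1 N,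
        (d : ℝ) * F d * (if d * j ≤ n then (M (n - d * j) : ℝ) else 0) := by exact_mod_cast e
    calc (M n : ℝ) * (n * y ^ n) = (n * M n) * y ^ n := by ring
      _ = _ := by
        rw [e', sum_mul]
        refine sum_congr rfl fun d _ => ?_
        rw [sum_mul]
        refine sum_congr rfl fun j _ => ?_
        split_ifs with hd
        · conv_lhs => rw [← Nat.add_sub_of_le hd, pow_add]
          simp only [Nat.add_sub_of_le hd]
          ring
        · simp
  rw [sum_congr rfl key, sum_comm, sum_mul]
  refine sum_le_sum fun d _ => ?_
  rw [sum_comm, sum_mul]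
  refine sum_le_sum fun j _ => ?_
  rw [← mul_sum]
  refine mul_le_mul_of_nonneg_left ?_ (by positivity)
  rw [← sum_filter]
  unfold trunc
  refine le_of_eq_of_le (sum_image (f := fun n => (M n : ℝ) * y ^ n) (g := fun n => n - d * j)
    ?_).symm ?_
  · intro a ha b hb hab
    simp only [coe_filter, mem_range, Set.mem_ofPred_eq] at ha hb hab
    omega
  · refine sum_le_sum_of_subset_of_nonneg ?_ fun _ _ _ => by positivity
    intro a ha
    simp only [mem_image, mem_filter, mem_range] at ha ⊢
    omega

lemma trunc_le_exp (h : IsEulerPair F M) (N : ℕ) {x : ℝ} (hx : 0 ≤ x) : trunc M N x ≤ Real.exp (expo F N x) := by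
  have dG : ∀ y, HasDerivAt (trunc M N)
      (∑ n ∈ range (N + 1), (M n : ℝ) * (n * y ^ (n - 1))) y := by
    intro y
    unfold trunc
    exact HasDerivAt.fun_sum fun n _ => (hasDerivAt_pow n y).const_mul _
  have dP : ∀ y, HasDerivAt (expo F N)
      (∑ d ∈ Icc 1 N, ∑ j ∈ Icc 1 N, (F d : ℝ) * (((d * j : ℕ) : ℝ) * y ^ (d * j - 1) / j)) y := by
    intro y
    unfold expo
    exact HasDerivAt.fun_sum fun d _ => HasDerivAt.fun_sum fun j _ =>
      ((hasDerivAt_pow (d * j) y).div_const _).const_mul _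
  have dH := fun y => (dG y).mul (dP y).neg.exp
  have anti : AntitoneOn (fun y => trunc M N y * Real.exp (-expo F N y)) (Set.Ici 0) := by
    refine antitoneOn_of_deriv_nonpos (convex_Ici 0)
      (fun y _ => (dH y).continuousAt.continuousWithinAt)
      (fun y _ => (dH y).differentiableAt.differentiableWithinAt) ?_
    intro y hy
    have hy0 : 0 < y := by simpa using hy
    refine le_of_eq_of_le (dH y).deriv ?_
    have e1 : y * ∑ n ∈ range (N + 1), (M n : ℝ) * (n * y ^ (n - 1)) =
        ∑ n ∈ range (N + 1), (M n : ℝ) * (n * y ^ n) := by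
      rw [mul_sum]
      refine sum_congr rfl fun n _ => ?_
      rcases n with _ | n
      · simp
      · simp [pow_succ]; ring
    have e2 : y * ∑ d ∈ Icc 1 N, ∑ j ∈ Icc 1 N,
        (F d : ℝ) * (((d * j : ℕ) : ℝ) * y ^ (d * j - 1) / j) =
        ∑ d ∈ Icc 1 N, ∑ j ∈ Icc 1 N, (F d : ℝ) * (d * y ^ (d * j)) := by
      rw [mul_sum]
      refine sum_congr rfl fun d hd => ?_
      rw [mul_sum]
      refine sum_congr rfl fun j hj => ?_
      have hj1 : 1 ≤ j := (mem_Icc.1 hj).1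
      have hd1 : 1 ≤ d := (mem_Icc.1 hd).1
      have hj0 : (j : ℝ) ≠ 0 := by positivity
      have : 1 ≤ d * j := Nat.mul_pos hd1 hj1
      rw [← Nat.sub_add_cancel this, pow_succ, Nat.sub_add_cancel this]
      push_cast
      field_simp
    have b := h.deriv_bound N hy0.le
    rw [← e1, ← e2] at b
    have b' : ∑ n ∈ range (N + 1), (M n : ℝ) * (n * y ^ (n - 1)) ≤
        (∑ d ∈ Icc 1 N, ∑ j ∈ Icc 1 N, (F d : ℝ) * (((d * j : ℕ) : ℝ) * y ^ (d * j - 1) / j)) *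
          trunc M N y := by
      refine le_of_mul_le_mul_left ?_ hy0
      linarith
    have := mul_le_mul_of_nonneg_right b' (Real.exp_pos (-expo F N y)).le
    simp only [Pi.neg_apply]
    linarith
  have := anti (Set.mem_Ici.2 le_rfl) (Set.mem_Ici.2 hx) hx
  have g0 : trunc M N 0 = 1 := by
    unfold trunc
    rw [sum_range_succ']
    simp [h.zero]
  have p0 : expo F N 0 = 0 := by
    unfold expo
    refine sum_eq_zero fun d hd => sum_eq_zero fun j hj => ?_
    have : d * j ≠ 0 := by
      have := (mem_Icc.1 hd).1
      have := (mem_Icc.1 hj).1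
      positivity
    simp [this]
  simp only [g0, p0, neg_zero, Real.exp_zero, mul_one] at this
  rw [Real.exp_neg, ← div_eq_mul_inv, div_le_one (Real.exp_pos _)] at this
  exact this

lemma expo_eq (h : IsEulerPair F M) (N : ℕ) (x : ℝ) : expo F N x = ∑ j ∈ Icc 1 N, trunc F N (x ^ j) / j := by
  unfold expo
  rw [sum_comm]
  refine sum_congr rfl fun j _ => ?_
  rw [h.trunc_eq_Icc, sum_div]
  refine sum_congr rfl fun d _ => ?_
  rw [mul_comm d j, pow_mul]
  ring

lemma trunc_pow_le (h : IsEulerPair F M) (N k j : ℕ) {x : ℝ} (hx : 0 ≤ x) (hx1 : x ≤ 1) (hj : 1 ≤ j)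
    (hS : trunc F N x ≤ 1) :
    trunc F N (x ^ j) ≤ ∑ d ∈ Icc 1 k, (F d : ℝ) * x ^ (j * d) + x ^ ((j - 1) * (k + 1)) := by
  rw [h.trunc_eq_Icc] at hS ⊢
  have : ∀ d ∈ Icc 1 N, (F d : ℝ) * (x ^ j) ^ d ≤
      (if d ∈ Icc 1 k then (F d : ℝ) * x ^ (j * d) else 0) +
        x ^ ((j - 1) * (k + 1)) * (F d * x ^ d) := by
    intro d hd
    rw [← pow_mul]
    split_ifs with hk
    · have : 0 ≤ x ^ ((j - 1) * (k + 1)) * (F d * x ^ d) := by positivity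
      linarith
    · rw [zero_add, mul_left_comm, ← pow_add]
      refine mul_le_mul_of_nonneg_left (pow_le_pow_of_le_one hx hx1 ?_) (by positivity)
      have : k + 1 ≤ d := by
        simp only [mem_Icc] at hd hk
        omega
      obtain ⟨i, rfl⟩ := Nat.exists_eq_add_of_le' hj
      simp only [Nat.add_sub_cancel]
      nlinarith [Nat.mul_le_mul_left i this]
  refine (sum_le_sum this).trans ?_
  rw [sum_add_distrib, ← mul_sum]
  refine add_le_add ?_ (mul_le_of_le_one_right (by positivity) hS)
  rw [← sum_filter]
  refine sum_le_sum_of_subset_of_nonneg ?_ fun _ _ _ => by positivity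
  intro a
  simp

lemma trunc_pow_ge (h : IsEulerPair F M) (N k j : ℕ) {x : ℝ} (hx : 0 ≤ x) (hk : k ≤ N) :
    ∑ d ∈ Icc 1 k, (F d : ℝ) * x ^ (j * d) ≤ trunc F N (x ^ j) := by
  rw [h.trunc_eq_Icc]
  simp only [← pow_mul]
  exact sum_le_sum_of_subset_of_nonneg (Icc_subset_Icc_right hk) fun _ _ _ => by positivity

lemma values (h : IsEulerPair F M) : F 1 = 1 ∧ F 2 = 2 ∧ F 3 = 5 ∧ F 4 = 13 ∧ F 5 = 37 ∧ F 6 = 108 ∧ F 7 = 332 := by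
  have f0 := h.F_zero
  have m0 := h.zero
  have f1 := h.F_succ 0
  have f2 := h.F_succ 1
  have f3 := h.F_succ 2
  have f4 := h.F_succ 3
  have f5 := h.F_succ 4
  have f6 := h.F_succ 5
  have f7 := h.F_succ 6
  have e1 := h.euler 1 1 le_rfl
  have e2 := h.euler 2 2 le_rfl
  have e3 := h.euler 3 3 le_rfl
  have e4 := h.euler 4 4 le_rfl
  have e5 := h.euler 5 5 le_rfl
  have e6 := h.euler 6 6 le_rfl
  norm_num [sum_Icc_succ_top, f0, m0] at f1
  norm_num [sum_Icc_succ_top, m0, f1] at e1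
  norm_num [sum_Icc_succ_top, e1, f1] at f2
  norm_num [sum_Icc_succ_top, m0, f1, f2, e1] at e2
  have m2 : M 2 = 3 := by omega
  norm_num [m2, f2] at f3
  norm_num [sum_Icc_succ_top, m0, f1, f2, f3, e1, m2] at e3
  have m3 : M 3 = 8 := by omega
  norm_num [m3, f3] at f4
  norm_num [sum_Icc_succ_top, m0, f1, f2, f3, f4, e1, m2, m3] at e4
  have m4 : M 4 = 24 := by omega
  norm_num [m4, f4] at f5
  norm_num [sum_Icc_succ_top, m0, f1, f2, f3, f4, f5, e1, m2, m3, m4] at e5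
  have m5 : M 5 = 71 := by omega
  norm_num [m5, f5] at f6
  norm_num [sum_Icc_succ_top, m0, f1, f2, f3, f4, f5, f6, e1, m2, m3, m4, m5] at e6
  have m6 : M 6 = 224 := by omega
  norm_num [m6, f6] at f7
  exact ⟨f1, f2, f3, f4, f5, f6, f7⟩

lemma expo_lt (h : IsEulerPair F M) {N : ℕ} (hS : trunc F N (100000 / 384899) ≤ 1) :
    expo F N (100000 / 384899) ≤ 1 + 0.04678 := by
  set x : ℝ := 100000 / 384899 with hx
  have hx0 : 0 ≤ x := by rw [hx]; norm_num
  have hx1 : x ≤ 1 := by rw [hx]; norm_num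
  obtain ⟨f1, f2, f3, f4, f5, f6, f7⟩ := h.values
  rw [h.expo_eq]
  have s1 : ∑ j ∈ Icc 1 N, trunc F N (x ^ j) / j ≤ ∑ j ∈ Icc 1 (8 + N), trunc F N (x ^ j) / j :=
    sum_le_sum_of_subset_of_nonneg (Icc_subset_Icc_right (by omega)) fun j _ _ =>
      div_nonneg (trunc_nonneg F N (by positivity)) (by positivity)
  have s2 : ∑ j ∈ Icc 1 (8 + N), trunc F N (x ^ j) / j =
      ∑ j ∈ Icc (1 : ℕ) 8, trunc F N (x ^ j) / (j : ℝ) +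
        ∑ j ∈ Icc 9 (8 + N), trunc F N (x ^ j) / j :=
    (sum_Ioc_consecutive (fun j : ℕ => trunc F N (x ^ j) / j) (show 0 ≤ 8 by omega)
      (show 8 ≤ 8 + N by omega)).symm
  have s3 : ∑ j ∈ Icc 9 (8 + N), trunc F N (x ^ j) / j ≤ x ^ 8 / (9 * (1 - x)) := by
    have hlt : x < 1 := by rw [hx]; norm_num
    calc ∑ j ∈ Icc 9 (8 + N), trunc F N (x ^ j) / j
        ≤ ∑ j ∈ Ico 9 (9 + N), x ^ (j - 1) / 9 := by
          rw [show Icc 9 (8 + N) = Ico 9 (9 + N) by ext; simp; omega]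
          refine sum_le_sum fun j hj => ?_
          have h9 : 9 ≤ j := (mem_Ico.1 hj).1
          have := h.trunc_pow_le N 0 j hx0 hx1 (by omega) hS
          simp only [zero_lt_one, Icc_eq_empty_of_lt, sum_empty, zero_add, mul_one] at this
          have h9' : (9 : ℝ) ≤ j := by exact_mod_cast h9
          exact div_le_div₀ (by positivity) this (by norm_num) h9'
      _ = x ^ 8 / 9 * ∑ j ∈ range N, x ^ j := by
          rw [sum_Ico_eq_sum_range, mul_sum]
          simp only [Nat.add_sub_cancel_left]
          refine sum_congr rfl fun j _ => ?_
          rw [show 9 + j - 1 = 8 + j by omega, pow_add]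
          ring
      _ ≤ x ^ 8 / 9 * (1 / (1 - x)) := by
          refine mul_le_mul_of_nonneg_left ?_ (by positivity)
          have hs := (summable_geometric_of_lt_one hx0 hlt).sum_le_tsum (range N)
            fun _ _ => by positivity
          rwa [tsum_geometric_of_lt_one hx0 hlt, ← one_div] at hs
      _ = _ := by
          have : 1 - x ≠ 0 := by linarith
          field_simp
  have t2 := h.trunc_pow_le N 7 2 hx0 hx1 (by omega) hS
  have t3 := h.trunc_pow_le N 3 3 hx0 hx1 (by omega) hS
  have t4 := h.trunc_pow_le N 2 4 hx0 hx1 (by omega) hS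
  have t5 := h.trunc_pow_le N 1 5 hx0 hx1 (by omega) hS
  have t6 := h.trunc_pow_le N 1 6 hx0 hx1 (by omega) hS
  have t7 := h.trunc_pow_le N 1 7 hx0 hx1 (by omega) hS
  have t8 := h.trunc_pow_le N 1 8 hx0 hx1 (by omega) hS
  refine s1.trans ?_
  rw [s2]
  simp only [sum_Icc_succ_top, Nat.reduceAdd, Icc_self, sum_singleton, f1, f2, f3,
    f4, f5, f6, f7, pow_one, Nat.one_le_ofNat] at t2 t3 t4 t5 t6 t7 t8 ⊢
  generalize trunc F N x = y1 at *
  generalize trunc F N (x ^ 2) = y2 at *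
  generalize trunc F N (x ^ 3) = y3 at *
  generalize trunc F N (x ^ 4) = y4 at *
  generalize trunc F N (x ^ 5) = y5 at *
  generalize trunc F N (x ^ 6) = y6 at *
  generalize trunc F N (x ^ 7) = y7 at *
  generalize trunc F N (x ^ 8) = y8 at *
  clear s1 s2
  rw [hx] at s3 t2 t3 t4 t5 t6 t7 t8
  norm_num at s3 t2 t3 t4 t5 t6 t7 t8 ⊢
  linarith

lemma trunc_le_one (h : IsEulerPair F M) (N : ℕ) : trunc F N (100000 / 384899) ≤ 1 := by
  induction N with
  | zero => simp [trunc, h.F_zero]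
  | succ N ih =>
    have e := h.mul_trunc N (100000 / 384899)
    have m := trunc_mono F (show (0 : ℝ) ≤ 100000 / 384899 by norm_num) (Nat.le_succ N)
    have b := h.trunc_le_exp N (show (0 : ℝ) ≤ 100000 / 384899 by norm_num)
    have u := Real.exp_le_exp.2 (h.expo_lt ih)
    rw [Real.exp_add] at u
    have e1 := Real.exp_one_lt_d9
    have e2 := Real.exp_bound' (x := 0.04678) (by norm_num) (by norm_num) (n := 4) (by norm_num)
    norm_num [sum_range_succ, Nat.factorial] at e2
    simp only [Nat.succ_eq_add_one] at m
    have := mul_le_mul e1.le e2 (Real.exp_pos _).le (by norm_num)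
    norm_num at this u
    linarith

lemma F_le (h : IsEulerPair F M) (n : ℕ) : (F n : ℝ) ≤ 3.84899 ^ n := by
  have h1 : (F n : ℝ) * (100000 / 384899) ^ n ≤ trunc F n (100000 / 384899) :=
    single_le_sum (f := fun n => (F n : ℝ) * (100000 / 384899) ^ n)
      (fun _ _ => by positivity) (self_mem_range_succ n)
  have h2 := h1.trans (h.trunc_le_one n)
  have h3 : ((100000 / 384899 : ℝ)) ^ n * 3.84899 ^ n = 1 := by
    rw [← mul_pow]; norm_num
  calc (F n : ℝ) = F n * (100000 / 384899) ^ n * 3.84899 ^ n := by rw [mul_assoc, h3, mul_one]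
    _ ≤ 1 * 3.84899 ^ n := by gcongr
    _ = _ := one_mul _

open Filter Topology

open Polynomial in
/-- `expo` as a polynomial. -/
noncomputable def expoPoly (F : ℕ → ℕ) (N : ℕ) : ℝ[X] :=
  ∑ d ∈ Icc 1 N, ∑ j ∈ Icc 1 N, C ((F d : ℝ) / j) * X ^ (d * j)

open Polynomial in
/-- The truncated exponential series of `expoPoly`. -/
noncomputable def expPoly (F : ℕ → ℕ) (N J : ℕ) : ℝ[X] :=
  ∑ i ∈ range (J + 1), C (1 / (i.factorial : ℝ)) * expoPoly F N ^ i

lemma eval_expoPoly (F : ℕ → ℕ) (N : ℕ) (x : ℝ) : (expoPoly F N).eval x = expo F N x := by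
  simp only [expoPoly, expo, Polynomial.eval_finsetSum, Polynomial.eval_mul, Polynomial.eval_C,
    Polynomial.eval_pow, Polynomial.eval_X]
  exact sum_congr rfl fun d _ => sum_congr rfl fun j _ => by ring

lemma tendsto_eval_expPoly (F : ℕ → ℕ) (N : ℕ) (x : ℝ) :
    Tendsto (fun J => (expPoly F N J).eval x) atTop (𝓝 (Real.exp (expo F N x))) := by
  have := (NormedSpace.expSeries_div_hasSum_exp (expo F N x)).tendsto_sum_nat
  rw [← Real.exp_eq_exp_ℝ] at this
  refine ((tendsto_add_atTop_iff_nat 1).2 this).congr fun J => ?_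
  simp only [expPoly, Polynomial.eval_finsetSum, Polynomial.eval_mul, Polynomial.eval_C,
    Polynomial.eval_pow, eval_expoPoly]
  exact sum_congr rfl fun d _ => by ring

open Polynomial in
lemma X_mul_derivative_expPoly (F : ℕ → ℕ) (N J : ℕ) :
    X * derivative (expPoly F N (J + 1)) =
      ∑ d ∈ Icc 1 N, ∑ j ∈ Icc 1 N, C ((d : ℝ) * F d) * (expPoly F N J * X ^ (d * j)) := by
  have e1 : derivative (expPoly F N (J + 1)) = derivative (expoPoly F N) * expPoly F N J := by
    unfold expPoly
    rw [sum_range_succ', derivative_add, derivative_sum, mul_sum]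
    simp only [pow_zero, mul_one, derivative_C, add_zero]
    refine sum_congr rfl fun i _ => ?_
    rw [derivative_C_mul, derivative_pow_succ, Nat.factorial_succ]
    have : C (1 / ((i.factorial : ℕ) : ℝ)) = C (1 / (((i + 1) * i.factorial : ℕ) : ℝ)) *
        C ((i : ℝ) + 1) := by
      rw [← C_mul]
      congr 1
      push_cast
      field_simp
    rw [this]
    ring
  have e2 : X * derivative (expoPoly F N) =
      ∑ d ∈ Icc 1 N, ∑ j ∈ Icc 1 N, C ((d : ℝ) * F d) * X ^ (d * j) := by
    unfold expoPoly
    rw [derivative_sum, mul_sum]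
    refine sum_congr rfl fun d hd => ?_
    rw [derivative_sum, mul_sum]
    refine sum_congr rfl fun j hj => ?_
    have hd1 : 1 ≤ d := (mem_Icc.1 hd).1
    have hj1 : 1 ≤ j := (mem_Icc.1 hj).1
    have hj0 : (j : ℝ) ≠ 0 := by positivity
    have : 1 ≤ d * j := Nat.mul_pos hd1 hj1
    rw [derivative_C_mul_X_pow, mul_left_comm, ← pow_succ', Nat.sub_add_cancel this]
    congr 2
    push_cast
    field_simp
  rw [e1, ← mul_assoc, e2, sum_mul]
  refine sum_congr rfl fun d _ => ?_
  rw [sum_mul]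
  exact sum_congr rfl fun j _ => by ring

open Polynomial in
lemma coeff_expPoly_le (h : IsEulerPair F M) (N J n : ℕ) : (expPoly F N J).coeff n ≤ M n := by
  have c0 : (expoPoly F N).coeff 0 = 0 := by
    simp only [expoPoly, finsetSum_coeff, coeff_C_mul, coeff_X_pow]
    refine sum_eq_zero fun d hd => sum_eq_zero fun j hj => ?_
    have : d * j ≠ 0 := by
      have := (mem_Icc.1 hd).1
      have := (mem_Icc.1 hj).1
      positivity
    simp [this.symm]
  induction J generalizing n with
  | zero =>
    simp only [expPoly, zero_add, range_one, sum_singleton, pow_zero, mul_one, Nat.factorial_zero,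
      Nat.cast_one, div_one, map_one, coeff_one]
    split_ifs with h0
    · simp [h0, h.zero]
    · positivity
  | succ J ih =>
    rcases Nat.eq_zero_or_pos n with rfl | hn
    · rw [coeff_zero_eq_eval_zero] at c0 ⊢
      simp only [expPoly, eval_finsetSum, eval_mul, eval_C, eval_pow, c0]
      rw [sum_range_succ', h.zero]
      simp
    · have hn0 : (0 : ℝ) < n := by exact_mod_cast hn
      refine le_of_mul_le_mul_left ?_ hn0
      have e : (n : ℝ) * (expPoly F N (J + 1)).coeff n =
          (X * derivative (expPoly F N (J + 1))).coeff n := by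
        obtain ⟨k, rfl⟩ := Nat.exists_eq_add_of_le' hn
        rw [coeff_X_mul, coeff_derivative]
        push_cast
        ring
      have e3 : (n : ℝ) * M n = ∑ d ∈ Icc 1 (N + n), ∑ j ∈ Icc 1 (N + n),
          (d : ℝ) * F d * (if d * j ≤ n then (M (n - d * j) : ℝ) else 0) := by
        exact_mod_cast h.euler n (N + n) (by omega)
      rw [e, X_mul_derivative_expPoly, e3]
      simp only [finsetSum_coeff, coeff_C_mul, coeff_mul_X_pow']
      have sub : Icc 1 N ⊆ Icc 1 (N + n) := Icc_subset_Icc_right (by omega)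
      have pos : ∀ d j : ℕ, 0 ≤ (d : ℝ) * F d * (if d * j ≤ n then (M (n - d * j) : ℝ) else 0) :=
        fun d j => by split_ifs <;> positivity
      refine (sum_le_sum fun d _ => ?_).trans (sum_le_sum_of_subset_of_nonneg sub fun d _ _ =>
        sum_nonneg fun j _ => pos d j)
      refine (sum_le_sum fun j _ => ?_).trans (sum_le_sum_of_subset_of_nonneg sub fun j _ _ =>
        pos d j)
      refine mul_le_mul_of_nonneg_left ?_ (by positivity)
      split_ifs
      · exact ih _
      · exact le_rfl

lemma exp_expo_le (h : IsEulerPair F M) {x L : ℝ} (hx : 0 ≤ x) (hL : ∀ N, trunc M N x ≤ L) (N : ℕ) :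
    Real.exp (expo F N x) ≤ L := by
  refine le_of_tendsto (tendsto_eval_expPoly F N x) (Eventually.of_forall fun J => ?_)
  rw [Polynomial.eval_eq_sum_range]
  exact (sum_le_sum fun n _ => mul_le_mul_of_nonneg_right (h.coeff_expPoly_le N J n)
    (by positivity)).trans (hL _)

lemma le_expo (h : IsEulerPair F M) (N : ℕ) :
    trunc F (N + 7) (100000 / 384801) + 0.04678 ≤ expo F (N + 7) (100000 / 384801) := by
  set x : ℝ := 100000 / 384801 with hx
  have hx0 : 0 ≤ x := by rw [hx]; norm_num
  obtain ⟨f1, f2, f3, f4, f5, f6, f7⟩ := h.values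
  rw [h.expo_eq]
  have s1 : ∑ j ∈ Icc (1 : ℕ) 7, trunc F (N + 7) (x ^ j) / (j : ℝ) ≤
      ∑ j ∈ Icc 1 (N + 7), trunc F (N + 7) (x ^ j) / j :=
    sum_le_sum_of_subset_of_nonneg (Icc_subset_Icc_right (by omega)) fun j _ _ =>
      div_nonneg (trunc_nonneg F _ (by positivity)) (by positivity)
  refine le_trans ?_ s1
  have t2 := h.trunc_pow_ge (N + 7) 7 2 hx0 (by omega)
  have t3 := h.trunc_pow_ge (N + 7) 4 3 hx0 (by omega)
  have t4 := h.trunc_pow_ge (N + 7) 3 4 hx0 (by omega)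
  have t5 := h.trunc_pow_ge (N + 7) 2 5 hx0 (by omega)
  have t6 := h.trunc_pow_ge (N + 7) 2 6 hx0 (by omega)
  have t7 := h.trunc_pow_ge (N + 7) 2 7 hx0 (by omega)
  simp only [sum_Icc_succ_top, Nat.reduceAdd, Icc_self, sum_singleton, f1, f2, f3,
    f4, f5, f6, f7, pow_one, Nat.one_le_ofNat] at t2 t3 t4 t5 t6 t7 ⊢
  clear s1
  generalize trunc F (N + 7) x = y1 at *
  generalize trunc F (N + 7) (x ^ 2) = y2 at *
  generalize trunc F (N + 7) (x ^ 3) = y3 at *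
  generalize trunc F (N + 7) (x ^ 4) = y4 at *
  generalize trunc F (N + 7) (x ^ 5) = y5 at *
  generalize trunc F (N + 7) (x ^ 6) = y6 at *
  generalize trunc F (N + 7) (x ^ 7) = y7 at *
  rw [hx] at t2 t3 t4 t5 t6 t7
  norm_num at t2 t3 t4 t5 t6 t7 ⊢
  linarith

lemma exists_one_le_trunc (h : IsEulerPair F M) : ∃ K, 1 ≤ trunc F K (100000 / 384801) := by
  by_contra! hK
  set x : ℝ := 100000 / 384801 with hx
  have hx0 : 0 < x := by rw [hx]; norm_num
  have bdd : BddAbove (Set.range fun N => trunc F N x) := by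
    refine ⟨1, ?_⟩
    rintro _ ⟨N, rfl⟩
    exact (hK N).le
  have lim := tendsto_atTop_ciSup (trunc_mono F hx0.le) bdd
  set S := ⨆ N, trunc F N x
  have limM : Tendsto (fun N => trunc M N x) atTop (𝓝 ((S - x * S) / x)) := by
    refine ((((tendsto_add_atTop_iff_nat 1).2 lim).sub (lim.const_mul x)).div_const x).congr
      fun N => ?_
    rw [← h.mul_trunc]
    field_simp
  have bM : ∀ N, trunc M N x ≤ (S - x * S) / x := fun N =>
    (trunc_mono M hx0.le).ge_of_tendsto limM N
  have b : Real.exp (S + 0.04678) ≤ (S - x * S) / x := by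
    have lim2 : Tendsto (fun N => Real.exp (trunc F (N + 7) x + 0.04678)) atTop
        (𝓝 (Real.exp (S + 0.04678))) :=
      (Real.continuous_exp.tendsto _).comp
        (((tendsto_add_atTop_iff_nat 7).2 lim).add_const _)
    exact le_of_tendsto lim2 (Eventually.of_forall fun N =>
      (Real.exp_le_exp.2 (h.le_expo N)).trans (h.exp_expo_le hx0.le bM _))
  have e1 := Real.add_one_le_exp (S - 1)
  have e2 := Real.exp_one_gt_d9
  have e3 := Real.sum_le_exp_of_nonneg (x := 0.04678) (by norm_num) 4
  norm_num [sum_range_succ, Nat.factorial] at e3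
  rw [show S + 0.04678 = (S - 1) + 1 + 0.04678 by ring, Real.exp_add, Real.exp_add] at b
  have e4 : (S - x * S) / x = 2.84801 * S := by
    rw [hx]
    ring
  rw [e4] at b
  have p := Real.exp_pos (S - 1)
  have q : (2.84802 : ℝ) ≤ Real.exp 1 * Real.exp 0.04678 := by
    rw [show (0.04678 : ℝ) = 2339 / 50000 by norm_num]
    refine le_trans ?_ (mul_le_mul e2.le e3 (by norm_num) (Real.exp_pos _).le)
    norm_num
  nlinarith

lemma convolution_le (h : IsEulerPair F M) (n : ℕ) :
    ∑ d ∈ range n, (d * F d) * F (n - d) ≤ n * F n := by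
  have a : ∀ i, ∑ d ∈ range (i + 1), d * F d * M (i - d) ≤ i * M i := by
    intro i
    rw [h.euler i i le_rfl, range_eq_Ico, sum_eq_sum_Ico_succ_bot (by omega)]
    simp only [zero_mul, zero_add]
    refine sum_le_sum fun d hd => ?_
    have hd1 : 1 ≤ d ∧ d ≤ i := by simpa [Nat.lt_succ_iff] using hd
    refine le_trans ?_ (single_le_sum (f := fun j => d * F d * if d * j ≤ i then M (i - d * j) else 0)
      (fun _ _ => Nat.zero_le _) (mem_Icc.2 ⟨le_rfl, hd1.1.trans hd1.2⟩))
    simp [hd1.2]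
  calc ∑ d ∈ range n, (d * F d) * F (n - d)
      = ∑ d ∈ range n, ∑ i ∈ Ico d n, d * F d * M (i - d) := by
        refine sum_congr rfl fun d _ => ?_
        rw [h.sum (n - d), mul_sum, sum_Ico_eq_sum_range]
        simp only [Nat.add_sub_cancel_left]
    _ = ∑ i ∈ range n, ∑ d ∈ range (i + 1), d * F d * M (i - d) := by
        refine sum_comm' fun d i => ?_
        simp only [mem_range, mem_Ico]
        omega
    _ ≤ ∑ i ∈ range n, i * M i := sum_le_sum fun i _ => a i
    _ ≤ ∑ i ∈ range n, n * M i := sum_le_sum fun i hi =>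
        Nat.mul_le_mul_right _ (mem_range.1 hi).le
    _ = n * F n := by rw [h.sum, mul_sum]

lemma F_pos (h : IsEulerPair F M) {n : ℕ} (hn : 1 ≤ n) : 1 ≤ F n := by
  induction n, hn using Nat.le_induction with
  | base => exact h.values.1.ge
  | succ n _ ih => rw [h.F_succ]; omega

lemma exists_le_F (h : IsEulerPair F M) : ∃ c : ℝ, 0 < c ∧ ∀ n, 1 ≤ n → c * 3.84801 ^ n ≤ n * F n := by
  obtain ⟨K, hK⟩ := h.exists_one_le_trunc
  set x : ℝ := 100000 / 384801 with hx
  have hx0 : 0 < x := by rw [hx]; norm_num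
  suffices H : ∃ c : ℝ, 0 < c ∧ ∀ n, 1 ≤ n → c ≤ (n * F n) * x ^ n by
    obtain ⟨c, hc, H⟩ := H
    refine ⟨c, hc, fun n hn => ?_⟩
    have h3 : x ^ n * 3.84801 ^ n = 1 := by
      rw [← mul_pow, hx]; norm_num
    calc c * 3.84801 ^ n ≤ (n * F n) * x ^ n * 3.84801 ^ n := by gcongr; exact H n hn
      _ = _ := by rw [mul_assoc, h3, mul_one]
  obtain ⟨m, hm, hmin⟩ := (Icc 1 (K + 1)).exists_min_image (fun n : ℕ => ((n : ℝ) * F n) * x ^ n)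
    ⟨1, by simp⟩
  refine ⟨(m * F m) * x ^ m, ?_, fun n => ?_⟩
  · have m1 : 1 ≤ m := (mem_Icc.1 hm).1
    have := h.F_pos m1
    positivity
  induction n using Nat.strong_induction_on with
  | _ n ih =>
    intro hn
    by_cases hnK : n ≤ K + 1
    · exact hmin n (mem_Icc.2 ⟨hn, hnK⟩)
    set c : ℝ := (m * F m) * x ^ m
    have hc : 0 ≤ c := by positivity
    have cv : ∑ d ∈ range n, ((d : ℝ) * F d) * F (n - d) ≤ n * F n := by
      exact_mod_cast h.convolution_le n
    calc c ≤ trunc F K x * c := le_mul_of_one_le_left hc hK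
      _ = ∑ j ∈ Icc 1 K, (F j : ℝ) * x ^ j * c := by rw [h.trunc_eq_Icc, sum_mul]
      _ ≤ ∑ j ∈ Icc 1 K, (F j : ℝ) * x ^ j * ((((n - j : ℕ) : ℝ) * F (n - j)) * x ^ (n - j)) := by
        refine sum_le_sum fun j hj => mul_le_mul_of_nonneg_left ?_ (by positivity)
        rw [mem_Icc] at hj
        exact ih (n - j) (by omega) (by omega)
      _ = (∑ j ∈ Icc 1 K, (((n - j : ℕ) : ℝ) * F (n - j)) * F (n - (n - j))) * x ^ n := by
        rw [sum_mul]
        refine sum_congr rfl fun j hj => ?_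
        rw [mem_Icc] at hj
        rw [show n - (n - j) = j by omega]
        conv_rhs => rw [show n = j + (n - j) by omega, pow_add]
        simp only [show j + (n - j) - j = n - j by omega]
        ring
      _ ≤ (n * F n) * x ^ n := by
        refine mul_le_mul_of_nonneg_right (le_trans ?_ cv) (by positivity)
        refine le_of_eq_of_le (sum_image (f := fun d : ℕ => ((d : ℝ) * F d) * F (n - d))
          (g := fun j => n - j) ?_).symm ?_
        · intro a ha b hb hab
          simp only [coe_Icc, Set.mem_Icc] at ha hb hab
          omega
        · refine sum_le_sum_of_subset_of_nonneg ?_ fun _ _ _ => by positivity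
          intro a ha
          simp only [mem_image, mem_Icc, mem_range] at ha ⊢
          omega

end IsEulerPair

/-- A bijective coding of finite rooted trees whose vertices carry natural numbers: a code
corresponds to the label of the root and the multiset of the codes of its subtrees. -/
def treeEquiv : ℕ ≃ ℕ × Multiset ℕ := (Denumerable.eqv (ℕ × Multiset ℕ)).symm

lemma lt_of_mem_raise {a : ℕ} (l : List ℕ) (n : ℕ) (ha : a ∈ Denumerable.raise l n) :
    a < n + Encodable.encode l := by
  induction l generalizing n with
  | nil => simp [Denumerable.raise] at ha
  | cons m l ih =>
    rw [Encodable.encode_list_cons]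
    have := Nat.add_le_pair m (Encodable.encode l)
    simp only [Denumerable.raise, List.mem_cons] at ha
    simp only [Encodable.encode_nat]
    rcases ha with rfl | ha
    · omega
    · have := ih _ ha
      omega

lemma lt_of_mem_ofNat {a k : ℕ} (ha : a ∈ Denumerable.ofNat (Multiset ℕ) k) : a < k := by
  have e : Denumerable.ofNat (Multiset ℕ) k = Multiset.map (Denumerable.ofNat ℕ)
      (Denumerable.raise (Denumerable.ofNat (List ℕ) k) 0) := rfl
  rw [e] at ha
  have ha' : a ∈ Denumerable.raise (Denumerable.ofNat (List ℕ) k) 0 := by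
    simpa using ha
  have := lt_of_mem_raise _ _ ha'
  simpa using this

lemma lt_of_mem_treeEquiv {a t : ℕ} (ha : a ∈ (treeEquiv t).2) : a < t := by
  have e : (treeEquiv t).2 = Denumerable.ofNat (Multiset ℕ) t.unpair.2 := by
    have : treeEquiv t = Denumerable.ofNat (ℕ × Multiset ℕ) t := rfl
    rw [this, Denumerable.prod_ofNat_val]
  rw [e] at ha
  exact (lt_of_mem_ofNat ha).trans_le (Nat.unpair_right_le t)

/-- The code of the tree with root label `w` and multiset of subtrees `m`. -/
def treeNode (w : ℕ) (m : Multiset ℕ) : ℕ := treeEquiv.symm (w, m)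

lemma treeNode_injective {w w' : ℕ} {m m' : Multiset ℕ} (h : treeNode w m = treeNode w' m') :
    w = w' ∧ m = m' := by simpa [treeNode] using h

lemma lt_treeNode {a w : ℕ} {m : Multiset ℕ} (ha : a ∈ m) : a < treeNode w m :=
  lt_of_mem_treeEquiv (by simpa [treeNode] using ha)

lemma treeNode_treeEquiv (t : ℕ) : treeNode (treeEquiv t).1 (treeEquiv t).2 = t := by
  simp [treeNode]

/-- The size of a tree: every vertex with label `w` counts `w + 1`. -/
def treeSize (t : ℕ) : ℕ :=
  (treeEquiv t).1 + 1 + ((treeEquiv t).2.attach.map fun a => treeSize a.1).sum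
termination_by t
decreasing_by exact lt_of_mem_treeEquiv a.2

lemma treeSize_treeNode (w : ℕ) (m : Multiset ℕ) :
    treeSize (treeNode w m) = w + 1 + (m.map treeSize).sum := by
  rw [treeSize]
  have := Multiset.attach_map_val' (treeEquiv (treeNode w m)).2 treeSize
  rw [this]
  simp [treeNode]

lemma treeSize_pos (t : ℕ) : 1 ≤ treeSize t := by
  rw [treeSize]; omega

lemma card_le_sum_treeSize (m : Multiset ℕ) : m.card ≤ (m.map treeSize).sum := by
  induction m using Multiset.induction_on with
  | empty => simp
  | cons a m ih =>
    have := treeSize_pos a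
    simp only [Multiset.card_cons, Multiset.map_cons, Multiset.sum_cons]
    omega

lemma treeSize_le_of_mem {a : ℕ} {m : Multiset ℕ} (ha : a ∈ m) :
    treeSize a ≤ (m.map treeSize).sum :=
  Multiset.single_le_sum (fun _ _ => Nat.zero_le _) _ (Multiset.mem_map_of_mem _ ha)

lemma finite_multiset_of_mem {s : Set ℕ} (hs : s.Finite) (n : ℕ) :
    {m : Multiset ℕ | (∀ a ∈ m, a ∈ s) ∧ m.card ≤ n}.Finite := by
  refine (Set.finite_Iic (n • hs.toFinset.val)).subset ?_
  rintro m ⟨h1, h2⟩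
  rw [Set.mem_Iic, Multiset.le_iff_count]
  intro a
  rw [Multiset.count_nsmul]
  by_cases ha : a ∈ m
  · have : 1 ≤ Multiset.count a hs.toFinset.val :=
      Multiset.one_le_count_iff_mem.2 (by simpa using h1 a ha)
    have := Multiset.count_le_card a m
    nlinarith
  · simp [Multiset.count_eq_zero_of_notMem ha]

lemma finite_treeSize_le (n : ℕ) : {t | treeSize t ≤ n}.Finite := by
  induction n with
  | zero =>
    convert Set.finite_empty
    ext t
    have := treeSize_pos t
    simp only [Set.mem_ofPred_eq, Set.mem_empty_iff_false, iff_false]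
    omega
  | succ n ih =>
    refine (((Set.finite_Iic n).prod (finite_multiset_of_mem ih n)).image
      fun p => treeNode p.1 p.2).subset ?_
    intro t ht
    refine ⟨treeEquiv t, ?_, treeNode_treeEquiv t⟩
    rw [← treeNode_treeEquiv t] at ht
    have h : treeSize (treeNode (treeEquiv t).1 (treeEquiv t).2) ≤ n + 1 := ht
    rw [treeSize_treeNode] at h
    refine ⟨?_, ?_, ?_⟩
    · simp only [Set.mem_Iic]
      omega
    · intro a ha
      have := treeSize_le_of_mem ha
      simp only [Set.mem_ofPred_eq]
      omega
    · have := card_le_sum_treeSize (treeEquiv t).2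
      omega

lemma finite_treeSize_eq (n : ℕ) : {t | treeSize t = n}.Finite :=
  (finite_treeSize_le n).subset fun _ h => le_of_eq h

lemma finite_sum_treeSize_eq (n : ℕ) : {m : Multiset ℕ | (m.map treeSize).sum = n}.Finite := by
  refine (finite_multiset_of_mem (finite_treeSize_le n) n).subset ?_
  intro m hm
  have hm' : (m.map treeSize).sum = n := hm
  exact ⟨fun a ha => (treeSize_le_of_mem ha).trans hm'.le,
    (card_le_sum_treeSize m).trans hm'.le⟩

/-- The trees of size `n`. -/
noncomputable def treesOfSize (n : ℕ) : Finset ℕ := (finite_treeSize_eq n).toFinset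

/-- The multisets of trees of total size `n`. -/
noncomputable def forestsOfSize (n : ℕ) : Finset (Multiset ℕ) :=
  (finite_sum_treeSize_eq n).toFinset

@[simp] lemma mem_treesOfSize {n t : ℕ} : t ∈ treesOfSize n ↔ treeSize t = n := by
  simp [treesOfSize]

@[simp] lemma mem_forestsOfSize {n : ℕ} {m : Multiset ℕ} :
    m ∈ forestsOfSize n ↔ (m.map treeSize).sum = n := by
  simp [forestsOfSize]

open Finset in
lemma card_filter_le_count (n t j : ℕ) :
    #{m ∈ forestsOfSize n | j ≤ m.count t} =
      if treeSize t * j ≤ n then #(forestsOfSize (n - treeSize t * j)) else 0 := by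
  split_ifs with h
  · rw [← card_image_of_injective (forestsOfSize (n - treeSize t * j))
      (add_left_injective (Multiset.replicate j t))]
    congr 1
    ext m
    rw [mem_filter, mem_forestsOfSize, mem_image]
    simp only [mem_forestsOfSize]
    constructor
    · rintro ⟨h1, h2⟩
      have h3 := Multiset.le_count_iff_replicate_le.1 h2
      refine ⟨m - Multiset.replicate j t, ?_, Multiset.sub_add_cancel h3⟩
      have h4 : ((m - Multiset.replicate j t + Multiset.replicate j t).map treeSize).sum = n := by
        rw [Multiset.sub_add_cancel h3, h1]
      simp only [Multiset.map_add, Multiset.sum_add, Multiset.map_replicate,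
        Multiset.sum_replicate, smul_eq_mul] at h4
      rw [mul_comm j] at h4
      omega
    · rintro ⟨m, h1, rfl⟩
      simp only [h1, Multiset.map_add, Multiset.sum_add, Multiset.map_replicate,
        Multiset.sum_replicate, smul_eq_mul, Multiset.count_add, Multiset.count_replicate_self]
      rw [mul_comm j]
      omega
  · rw [card_eq_zero, filter_eq_empty_iff]
    intro m hm hj
    rw [mem_forestsOfSize] at hm
    have h3 := Multiset.le_count_iff_replicate_le.1 hj
    have h4 : ((m - Multiset.replicate j t + Multiset.replicate j t).map treeSize).sum = n := by
      rw [Multiset.sub_add_cancel h3, hm]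
    simp only [Multiset.map_add, Multiset.sum_add, Multiset.map_replicate,
      Multiset.sum_replicate, smul_eq_mul] at h4
    rw [mul_comm j] at h4
    omega

open Finset in
lemma isEulerPair_trees :
    IsEulerPair (fun n => #(treesOfSize n)) (fun n => #(forestsOfSize n)) where
  zero := by
    rw [card_eq_one]
    refine ⟨0, ?_⟩
    ext m
    simp only [mem_forestsOfSize, mem_singleton]
    constructor
    · intro h
      have := card_le_sum_treeSize m
      rw [h] at this
      exact Multiset.card_eq_zero.1 (by omega)
    · rintro rfl
      simp
  sum n := by
    have e : treesOfSize n =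
        (range n).biUnion fun i => (forestsOfSize i).image (treeNode (n - 1 - i)) := by
      ext t
      simp only [mem_treesOfSize, mem_biUnion, mem_range, mem_image, mem_forestsOfSize]
      constructor
      · intro h
        rw [← treeNode_treeEquiv t, treeSize_treeNode] at h
        refine ⟨_, ?_, (treeEquiv t).2, rfl, ?_⟩
        · omega
        · conv_rhs => rw [← treeNode_treeEquiv t]
          congr 1
          omega
      · rintro ⟨i, hi, m, rfl, rfl⟩
        rw [treeSize_treeNode]
        omega
    rw [e, card_biUnion]
    · exact sum_congr rfl fun i _ =>
        card_image_of_injective _ fun m m' h => (treeNode_injective h).2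
    · intro i hi j hj hij
      rw [Function.onFun, disjoint_left]
      intro t h1 h2
      obtain ⟨m, -, rfl⟩ := mem_image.1 h1
      obtain ⟨m', -, h⟩ := mem_image.1 h2
      have := (treeNode_injective h).1
      simp only [coe_range, Set.mem_Iio] at hi hj
      omega
  euler n N hN := by
    set T := (Icc 1 N).biUnion treesOfSize with hT
    have hmT : ∀ t, t ∈ T ↔ treeSize t ≤ N := by
      intro t
      have := treeSize_pos t
      simp only [hT, mem_biUnion, mem_Icc, mem_treesOfSize]
      constructor
      · rintro ⟨d, hd, rfl⟩
        exact hd.2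
      · exact fun h => ⟨_, ⟨this, h⟩, rfl⟩
    have a : ∀ m ∈ forestsOfSize n, n =
        ∑ t ∈ T, ∑ j ∈ Icc 1 N, treeSize t * if j ≤ m.count t then 1 else 0 := by
      intro m hm
      rw [mem_forestsOfSize] at hm
      conv_lhs => rw [← hm, Finset.sum_multiset_map_count]
      rw [sum_subset (s₂ := T)]
      · refine sum_congr rfl fun t _ => ?_
        rw [← mul_sum, smul_eq_mul, mul_comm, sum_boole]
        congr 1
        have hc : m.count t ≤ N :=
          (Multiset.count_le_card t m).trans ((card_le_sum_treeSize m).trans (hm.le.trans hN))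
        have : {j ∈ Icc 1 N | j ≤ m.count t} = Icc 1 (m.count t) := by
          ext j
          simp only [mem_filter, mem_Icc]
          omega
        rw [this]
        simp
      · intro t ht
        rw [hmT]
        exact (treeSize_le_of_mem (Multiset.mem_toFinset.1 ht)).trans (hm.le.trans hN)
      · intro t _ ht
        rw [Multiset.mem_toFinset] at ht
        simp [ht]
    calc n * #(forestsOfSize n) = ∑ m ∈ forestsOfSize n, n := by simp [mul_comm]
      _ = ∑ m ∈ forestsOfSize n,
          ∑ t ∈ T, ∑ j ∈ Icc 1 N, treeSize t * if j ≤ m.count t then 1 else 0 := sum_congr rfl a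
      _ = ∑ t ∈ T, ∑ j ∈ Icc 1 N, treeSize t * #{m ∈ forestsOfSize n | j ≤ m.count t} := by
        rw [sum_comm]
        refine sum_congr rfl fun t _ => ?_
        rw [sum_comm]
        refine sum_congr rfl fun j _ => ?_
        rw [← mul_sum, sum_boole]
        simp
      _ = ∑ d ∈ Icc 1 N, ∑ t ∈ treesOfSize d, ∑ j ∈ Icc 1 N,
          d * if d * j ≤ n then #(forestsOfSize (n - d * j)) else 0 := by
        rw [hT, sum_biUnion]
        · refine sum_congr rfl fun d _ => sum_congr rfl fun t ht => sum_congr rfl fun j _ => ?_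
          rw [card_filter_le_count, mem_treesOfSize.1 ht]
        · intro d _ d' _ hd
          rw [Function.onFun, disjoint_left]
          intro t h1 h2
          rw [mem_treesOfSize] at h1 h2
          omega
      _ = _ := by
        refine sum_congr rfl fun d _ => ?_
        rw [sum_const, smul_eq_mul, mul_sum]
        exact sum_congr rfl fun j _ => by ring

/-- A rooted tree on the vertex set `B`, given by its parent function (which fixes the root). -/
structure ParentTree (B : Type) where
  root : B
  par : B → B
  depth : B → ℕ
  par_root : par root = root
  depth_root : depth root = 0
  depth_par : ∀ b, b ≠ root → depth b = depth (par b) + 1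

namespace ParentTree

open Finset

variable {B B' : Type} (S : ParentTree B) (S' : ParentTree B')

lemma depth_par_le (b : B) : S.depth (S.par b) ≤ S.depth b := by
  by_cases h : b = S.root
  · rw [h, S.par_root]
  · have := S.depth_par b h
    omega

lemma par_ne {b : B} (h : b ≠ S.root) : S.par b ≠ b := by
  intro e
  have := S.depth_par b h
  rw [e] at this
  omega

/-- The underlying simple graph of a rooted tree. -/
def graph : SimpleGraph B where
  Adj u v := u ≠ v ∧ (S.par u = v ∨ S.par v = u)
  symm := ⟨fun _ _ h => ⟨h.1.symm, h.2.symm⟩⟩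
  loopless := ⟨fun _ h => h.1 rfl⟩

lemma graph_adj_par {b : B} (h : b ≠ S.root) : S.graph.Adj b (S.par b) :=
  ⟨(S.par_ne h).symm, Or.inl rfl⟩

lemma induction_par {P : B → Prop} (h0 : P S.root)
    (h1 : ∀ b, b ≠ S.root → P (S.par b) → P b) (b : B) : P b := by
  induction hn : S.depth b using Nat.strong_induction_on generalizing b with
  | _ n ih =>
    by_cases hb : b = S.root
    · rwa [hb]
    · exact h1 b hb (ih _ (by have := S.depth_par b hb; omega) _ rfl)

lemma graph_connected : S.graph.Connected := by
  have h : ∀ b, S.graph.Reachable b S.root := S.induction_par (SimpleGraph.Reachable.refl _)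
    fun b hb h => (S.graph_adj_par hb).reachable.trans h
  exact { preconnected := fun u v => (h u).trans (h v).symm, nonempty := ⟨S.root⟩ }

lemma graph_isTree [Finite B] : S.graph.IsTree := by
  rw [SimpleGraph.isTree_iff_connected_and_card]
  refine ⟨S.graph_connected, le_antisymm ?_ S.graph_connected.card_vert_le_card_edgeSet_add_one⟩
  have hsub : S.graph.edgeSet ⊆ (fun b => s(b, S.par b)) '' {S.root}ᶜ := by
    intro e
    induction e using Sym2.ind with
    | _ u v =>
      rintro ⟨hne, h | h⟩
      · refine ⟨u, ?_, by simp [h]⟩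
        rintro rfl
        exact hne (S.par_root.symm.trans h)
      · refine ⟨v, ?_, by simp [h, Sym2.eq_swap]⟩
        rintro rfl
        exact hne (h.symm.trans S.par_root)
  have h1 := (Set.ncard_le_ncard hsub (Set.toFinite _)).trans
    (Set.ncard_image_le (Set.toFinite _))
  have h2 := Set.ncard_add_ncard_compl ({S.root} : Set B)
  rw [Set.ncard_singleton] at h2
  rw [Nat.card_coe_set_eq]
  omega

/-- Every tree can be rooted at any vertex. -/
lemma exists_graph_eq {T : SimpleGraph B} (hT : T.IsTree) (r : B) :
    ∃ S : ParentTree B, S.root = r ∧ S.graph = T := by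
  classical
  have ex : ∀ b, b ≠ r → ∃ c, T.Adj b c ∧ T.dist r b = T.dist r c + 1 := by
    intro b hb
    obtain ⟨p, hp⟩ := hT.connected.exists_walk_length_eq_dist b r
    cases p with
    | nil => exact absurd rfl hb
    | @cons _ c _ hadj q =>
      refine ⟨c, hadj, ?_⟩
      have h1 := SimpleGraph.dist_le q
      rw [SimpleGraph.Walk.length_cons] at hp
      have h2 := hT.dist_eq_dist_add_one_of_adj r hadj
      rw [SimpleGraph.dist_comm (u := r) (v := b), SimpleGraph.dist_comm (u := r) (v := c)] at *
      omega
  choose! f hf1 hf2 using ex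
  let S : ParentTree B :=
    { root := r
      par := fun b => if b = r then r else f b
      depth := T.dist r
      par_root := by simp
      depth_root := by simp
      depth_par := fun b hb => by simp only [hb, if_false]; exact hf2 b hb }
  refine ⟨S, rfl, ?_⟩
  have hpar : ∀ b, b ≠ r → S.par b = f b := fun b hb => if_neg hb
  have hle : S.graph ≤ T := by
    rintro u v ⟨hne, h⟩
    have key : ∀ a b, a ≠ b → S.par a = b → T.Adj a b := by
      intro a b hab h
      by_cases ha : a = r
      · subst ha
        exact absurd (S.par_root.symm.trans h) hab
      · rw [hpar a ha] at h
        exact h ▸ hf1 a ha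
    rcases h with h | h
    · exact key u v hne h
    · exact (key v u hne.symm h).symm
  exact (SimpleGraph.isTree_iff_minimal_connected.1 hT).eq_of_le S.graph_connected hle

/-- Equal or adjacent vertices of a rooted tree. -/
def Near (u v : B) : Prop := u = v ∨ S.par u = v ∨ S.par v = u

lemma near_comm {u v : B} : S.Near u v ↔ S.Near v u := by
  unfold Near
  tauto

lemma near_iff {u v : B} : S.Near u v ↔ u = v ∨ S.graph.Adj u v := by
  unfold Near graph
  by_cases h : u = v <;> simp [h]

/-- The root has at least two children. -/
def Branching : Prop :=
  ∃ c c', c ≠ c' ∧ c ≠ S.root ∧ c' ≠ S.root ∧ S.par c = S.root ∧ S.par c' = S.root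

lemma eq_of_near_iff (hS : S.Branching) {u v : B} (h : ∀ b, S.Near b u ↔ S.Near b v) :
    u = v := by
  have key : ∀ u v, (∀ b, S.Near b u ↔ S.Near b v) → S.par u = v → u = v := by
    intro u v h huv
    by_contra hne
    have hu : u ≠ S.root := by
      rintro rfl
      exact hne (S.par_root.symm.trans huv)
    by_cases hv : v = S.root
    · obtain ⟨c, hcu, hc, hcr⟩ : ∃ c, c ≠ u ∧ c ≠ S.root ∧ S.par c = S.root := by
        obtain ⟨c, c', hcc, hc, hc', h1, h2⟩ := hS
        by_cases e : c = u
        · exact ⟨c', fun e' => hcc (e.trans e'.symm), hc', h2⟩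
        · exact ⟨c, e, hc, h1⟩
      rcases (h c).2 (Or.inr (Or.inl (hcr.trans hv.symm))) with e | e | e
      · exact hcu e
      · exact hu (e.symm.trans hcr)
      · exact hc (e.symm.trans (huv.trans hv))
    · have d1 := S.depth_par u hu
      have d2 := S.depth_par v hv
      have d3 := S.depth_par_le (S.par v)
      rw [huv] at d1
      rcases (h (S.par v)).2 (Or.inr (Or.inr rfl)) with e | e | e
      · rw [← e] at d1
        omega
      · rw [← e] at d1
        omega
      · exact S.par_ne hv (e.symm.trans huv)
  rcases (h u).1 (Or.inl rfl) with e | e | e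
  · exact e
  · exact key u v h e
  · exact (key v u (fun b => (h b).symm) e).symm

lemma card_subtype_coe_eq (s : Finset B) (g : B → ℕ) (k : ℕ)
    [DecidablePred fun c : s => g c = k] :
    Fintype.card {c : s // g c = k} = #{c ∈ s | g c = k} := by
  rw [← Fintype.card_coe]
  exact Fintype.card_congr ((Equiv.subtypeSubtypeEquivSubtypeInter (· ∈ s) (g · = k)).trans
    (Equiv.subtypeEquivRight fun c => by simp))

section Code

variable [Fintype B] [Fintype B'] (w : B → ℕ) (w' : B' → ℕ)

open Classical in
/-- The children of a vertex. -/
noncomputable def children (b : B) : Finset B := {c | c ≠ S.root ∧ S.par c = b}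

@[simp] lemma mem_children {b c : B} : c ∈ S.children b ↔ c ≠ S.root ∧ S.par c = b := by
  simp [children]

lemma depth_le_sup (b : B) : S.depth b ≤ univ.sup S.depth := le_sup (mem_univ b)

lemma depth_of_mem_children {b c : B} (h : c ∈ S.children b) : S.depth c = S.depth b + 1 := by
  rw [mem_children] at h
  rw [S.depth_par c h.1, h.2]

lemma sup_sub_depth_lt {b c : B} (h : c ∈ S.children b) :
    univ.sup S.depth - S.depth c < univ.sup S.depth - S.depth b := by
  have := S.depth_of_mem_children h
  have := S.depth_le_sup c
  omega

lemma induction_children {P : B → Prop} (h : ∀ b, (∀ c ∈ S.children b, P c) → P b) (b : B) :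
    P b := by
  induction hn : univ.sup S.depth - S.depth b using Nat.strong_induction_on generalizing b with
  | _ n ih => exact h b fun c hc => ih _ (hn ▸ S.sup_sub_depth_lt hc) c rfl

/-- The code of the subtree below a vertex, for a rooted tree with vertex labels `w`. -/
noncomputable def code (b : B) : ℕ :=
  treeNode (w b) ((S.children b).attach.val.map fun c => code c.1)
termination_by univ.sup S.depth - S.depth b
decreasing_by exact S.sup_sub_depth_lt c.2

lemma code_eq (b : B) : S.code w b = treeNode (w b) ((S.children b).val.map (S.code w)) := by
  rw [code]
  congr 1
  exact Multiset.attach_map_val' _ (S.code w)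

lemma treeSize_code_root : treeSize (S.code w S.root) = ∑ b, (w b + 1) := by
  classical
  have h : ∀ b, treeSize (S.code w b) =
      (w b + 1) + ∑ c ∈ S.children b, treeSize (S.code w c) := by
    intro b
    rw [code_eq, treeSize_treeNode, Multiset.map_map]
    rfl
  have h1 : ∑ b, treeSize (S.code w b) = ∑ b, (w b + 1) +
      ∑ b, ∑ c ∈ S.children b, treeSize (S.code w c) := by
    rw [← sum_add_distrib]
    exact sum_congr rfl fun b _ => h b
  have h2 : ∑ b, ∑ c ∈ S.children b, treeSize (S.code w c) =
      ∑ c ∈ univ.erase S.root, treeSize (S.code w c) := by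
    refine sum_comm' (t' := univ.erase S.root) (s' := fun c => {S.par c}) (fun b c => ?_) |>.trans ?_
    · simp only [mem_univ, mem_children, mem_singleton, mem_erase]
      tauto
    · simp
  have h3 := add_sum_erase univ (fun c => treeSize (S.code w c)) (mem_univ S.root)
  omega

variable {w w'}

lemma code_map_eq {φ : B → B'} (hφ : Function.Bijective φ) (h0 : φ S.root = S'.root)
    (hpar : ∀ b, φ (S.par b) = S'.par (φ b)) (hw : ∀ b, w b = w' (φ b)) (b : B) :
    S'.code w' (φ b) = S.code w b := by
  induction b using S.induction_children with
  | h b ih =>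
    rw [code_eq, code_eq, hw]
    congr 1
    have e : S'.children (φ b) = (S.children b).map ⟨φ, hφ.1⟩ := by
      ext c'
      obtain ⟨c, rfl⟩ := hφ.2 c'
      simp only [mem_map, mem_children, Function.Embedding.coeFn_mk]
      constructor
      · rintro ⟨h1, h2⟩
        exact ⟨c, ⟨fun e => h1 (by rw [e, h0]), hφ.injective (by rw [hpar, h2])⟩, rfl⟩
      · rintro ⟨d, ⟨h1, h2⟩, e⟩
        obtain rfl := hφ.injective e
        exact ⟨fun e => h1 (hφ.injective (e.trans h0.symm)), by rw [← hpar, h2]⟩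
    rw [e, map_val, Multiset.map_map]
    exact Multiset.map_congr rfl fun c hc => ih c hc

lemma exists_bijOn_children {b : B} {b' : B'} (h : S.code w b = S'.code w' b') :
    ∃ f : B → B', Set.BijOn f (S.children b) (S'.children b') ∧
      ∀ c ∈ S.children b, S'.code w' (f c) = S.code w c := by
  classical
  rw [code_eq, code_eq] at h
  have hm := (treeNode_injective h).2
  have card : ∀ k, Fintype.card {c : S.children b // S.code w c = k} =
      Fintype.card {c : S'.children b' // S'.code w' c = k} := by
    intro k
    have := congrArg (Multiset.count k) hm
    rw [Multiset.count_map, Multiset.count_map] at this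
    rw [card_subtype_coe_eq, card_subtype_coe_eq]
    simpa [Finset.card, Finset.filter, eq_comm] using this
  let E : S.children b ≃ S'.children b' := Equiv.ofFiberEquiv
    (f := fun c => S.code w c) (g := fun c => S'.code w' c)
    fun k => Fintype.equivOfCardEq (card k)
  have hE : ∀ c, S'.code w' (E c) = S.code w c := fun c =>
    Equiv.ofFiberEquiv_map (g := fun c : S'.children b' => S'.code w' c) _ c
  refine ⟨fun c => if hc : c ∈ S.children b then E ⟨c, hc⟩ else S'.root, ⟨?_, ?_, ?_⟩, ?_⟩
  · intro c hc
    have hc' : c ∈ S.children b := hc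
    simp only [hc', dif_pos]
    exact (E ⟨c, hc'⟩).2
  · intro c hc d hd hcd
    have hc' : c ∈ S.children b := hc
    have hd' : d ∈ S.children b := hd
    simp only [hc', hd', dif_pos] at hcd
    simpa using E.injective (Subtype.ext hcd)
  · intro c' hc'
    obtain ⟨c, hc⟩ := E.surjective ⟨c', hc'⟩
    refine ⟨c, c.2, ?_⟩
    simp [hc]
  · intro c hc
    simp only [hc, dif_pos]
    exact hE ⟨c, hc⟩

open Classical in
/-- The map of rooted trees which sends the root to the root and is given by `β u (φ u)` on the
children of `u`. -/
noncomputable def extend (S : ParentTree B) (S' : ParentTree B') (β : B → B' → B → B') (b : B) :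
    B' :=
  if h : b = S.root then S'.root else β (S.par b) (extend S S' β (S.par b)) b
termination_by S.depth b
decreasing_by
  have := S.depth_par b h
  omega

lemma exists_bijective_of_code_eq (hcode₀ : S.code w S.root = S'.code w' S'.root) :
    ∃ φ : B → B', Function.Bijective φ ∧ φ S.root = S'.root ∧
      (∀ b, φ (S.par b) = S'.par (φ b)) ∧ ∀ b, w b = w' (φ b) := by
  have ex : ∀ b b', S.code w b = S'.code w' b' → ∃ f : B → B',
      Set.BijOn f (S.children b) (S'.children b') ∧
      ∀ c ∈ S.children b, S'.code w' (f c) = S.code w c :=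
    fun _ _ => exists_bijOn_children S S'
  have : Nonempty B' := ⟨S'.root⟩
  choose! β hβ hβc using ex
  set φ := extend S S' β
  have h0 : φ S.root = S'.root := by
    simp only [φ]
    rw [extend, dif_pos rfl]
  have h1 : ∀ b, b ≠ S.root → φ b = β (S.par b) (φ (S.par b)) b := by
    intro b hb
    simp only [φ]
    rw [extend, dif_neg hb]
  have hmem : ∀ {b}, b ≠ S.root → b ∈ S.children (S.par b) := fun hb => by simp [hb]
  have hcode : ∀ b, S.code w b = S'.code w' (φ b) := by
    refine S.induction_par (by rw [h0, hcode₀]) fun b hb ih => ?_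
    rw [h1 b hb, hβc _ _ ih b (hmem hb)]
  have hch : ∀ b, b ≠ S.root → φ b ∈ S'.children (φ (S.par b)) := by
    intro b hb
    have := (hβ _ _ (hcode (S.par b))).mapsTo (mem_coe.2 (hmem hb))
    rwa [← h1 b hb] at this
  have hne : ∀ b, b ≠ S.root → φ b ≠ S'.root := fun b hb => ((S'.mem_children).1 (hch b hb)).1
  have hpar : ∀ b, φ (S.par b) = S'.par (φ b) := by
    intro b
    by_cases hb : b = S.root
    · rw [hb, S.par_root, h0, S'.par_root]
    · exact ((S'.mem_children).1 (hch b hb)).2.symm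
  refine ⟨φ, ⟨?_, ?_⟩, h0, hpar, fun b => ?_⟩
  · intro b
    induction b using S.induction_par with
    | h0 =>
      intro b₂ e
      by_contra hb
      exact hne b₂ (Ne.symm hb) (e.symm.trans h0)
    | h1 b hb ih =>
      intro b₂ e
      have hb₂ : b₂ ≠ S.root := by
        rintro rfl
        exact hne b hb (e.trans h0)
      have hp : S.par b = S.par b₂ := ih (by rw [hpar, hpar, e])
      rw [h1 b hb, h1 b₂ hb₂, ← hp] at e
      exact (hβ _ _ (hcode (S.par b))).injOn (mem_coe.2 (hmem hb))
        (mem_coe.2 (hp ▸ hmem hb₂)) e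
  · intro b'
    induction b' using S'.induction_par with
    | h0 => exact ⟨_, h0⟩
    | h1 b' hb' ih =>
      obtain ⟨u, hu⟩ := ih
      obtain ⟨c, hc, e⟩ := (hβ _ _ (hcode u)).surjOn
        (mem_coe.2 ((S'.mem_children).2 ⟨hb', hu.symm⟩))
      rw [mem_coe, mem_children] at hc
      refine ⟨c, ?_⟩
      rw [h1 c hc.1, hc.2, e]
  · have := hcode b
    rw [code_eq, code_eq] at this
    exact (treeNode_injective this).1

end Code

end ParentTree

namespace ParentTree

open Finset

variable {B B' X X' : Type}

lemma par_par_ne (S : ParentTree B) {b : B} (h : b ≠ S.root) : S.par (S.par b) ≠ b := by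
  intro e
  have h1 := S.depth_par b h
  have h2 := S.depth_par_le (S.par b)
  rw [e] at h2
  omega

lemma map_par_of_near_iff (S : ParentTree B) (S' : ParentTree B') {φ : B → B'}
    (hφ : Function.Injective φ) (h0 : φ S.root = S'.root)
    (h : ∀ u v, S'.Near (φ u) (φ v) ↔ S.Near u v) (b : B) : φ (S.par b) = S'.par (φ b) := by
  induction b using S.induction_par with
  | h0 => rw [S.par_root, h0, S'.par_root]
  | h1 b hb ih =>
    rcases (h b (S.par b)).2 (Or.inr (Or.inl rfl)) with e | e | e
    · exact absurd (hφ e).symm (S.par_ne hb)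
    · exact e.symm
    · exact absurd (hφ (ih.trans e)) (S.par_par_ne hb)

lemma near_map_iff (S : ParentTree B) (S' : ParentTree B') {φ : B → B'}
    (hφ : Function.Injective φ) (h : ∀ b, φ (S.par b) = S'.par (φ b)) (u v : B) :
    S'.Near (φ u) (φ v) ↔ S.Near u v := by
  unfold Near
  rw [← h, ← h, hφ.eq_iff, hφ.eq_iff, hφ.eq_iff]

/-- The graph obtained from a tree by replacing every vertex `b` by the clique `p ⁻¹' {b}`. -/
def bagGraph (S : ParentTree B) (p : X → B) : SimpleGraph X where
  Adj x y := x ≠ y ∧ S.Near (p x) (p y)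
  symm := ⟨fun _ _ h => ⟨h.1.symm, S.near_comm.1 h.2⟩⟩
  loopless := ⟨fun _ h => h.1 rfl⟩

lemma near_iff_bagGraph (S : ParentTree B) (p : X → B) {x y : X} :
    S.Near (p x) (p y) ↔ x = y ∨ (S.bagGraph p).Adj x y := by
  by_cases h : x = y
  · simp [h, Near]
  · simp [bagGraph, h]

/-- The label of a vertex `b` is one less than the size of the clique `p ⁻¹' {b}`. -/
noncomputable def bagLabel (p : X → B) (b : B) : ℕ := Nat.card {x // p x = b} - 1

lemma bagLabel_add_one [Finite X] {p : X → B} (hp : Function.Surjective p) (b : B) :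
    bagLabel p b + 1 = Nat.card {x // p x = b} := by
  obtain ⟨x, hx⟩ := hp b
  have : Nonempty {x // p x = b} := ⟨⟨x, hx⟩⟩
  have := Nat.card_pos (α := {x // p x = b})
  unfold bagLabel
  omega

variable [Fintype B] [Fintype B']

/-- The code of a rooted tree with vertices replaced by cliques. -/
noncomputable def bagCode (S : ParentTree B) (p : X → B) : ℕ := S.code (bagLabel p) S.root

lemma treeSize_bagCode [Fintype X] (S : ParentTree B) {p : X → B}
    (hp : Function.Surjective p) : treeSize (S.bagCode p) = Fintype.card X := by
  classical
  rw [bagCode, treeSize_code_root, ← Fintype.card_congr (Equiv.sigmaFiberEquiv p),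
    Fintype.card_sigma]
  exact sum_congr rfl fun b _ => by rw [bagLabel_add_one hp, Nat.card_eq_fintype_card]

lemma exists_iso_of_bagCode_eq [Finite X] [Finite X'] {S : ParentTree B} {S' : ParentTree B'}
    {p : X → B} {p' : X' → B'} (hp : Function.Surjective p) (hp' : Function.Surjective p')
    (h : S.bagCode p = S'.bagCode p') {x : X} {x' : X'} (hx : p x = S.root)
    (hx' : p' x' = S'.root) : ∃ Φ : S.bagGraph p ≃g S'.bagGraph p', Φ x = x' := by
  classical
  obtain ⟨φ, hφ, h0, hpar, hw⟩ := exists_bijective_of_code_eq S S' h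
  have card : ∀ c, Nat.card {x // φ (p x) = c} = Nat.card {x' // p' x' = c} := by
    intro c
    obtain ⟨b, rfl⟩ := hφ.2 c
    rw [← bagLabel_add_one hp', ← hw, bagLabel_add_one hp]
    exact Nat.card_congr (Equiv.subtypeEquivRight fun x => hφ.1.eq_iff)
  let e : X ≃ X' := Equiv.ofFiberEquiv (f := fun x => φ (p x)) (g := p')
    fun c => (Finite.card_eq.1 (card c)).some
  have he : ∀ y, p' (e y) = φ (p y) := fun y => Equiv.ofFiberEquiv_map (g := p') _ y
  let e' : X ≃ X' := e.trans (Equiv.swap (e x) x')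
  have he' : ∀ y, p' (e' y) = φ (p y) := by
    intro y
    simp only [e', Equiv.trans_apply, Equiv.swap_apply_def, ← he]
    split_ifs with h1 h2
    · rw [h1, he, hx, hx', h0]
    · rw [h2, he, hx, hx', h0]
    · rfl
  refine ⟨⟨e', fun {a b} => ?_⟩, by simp [e']⟩
  simp only [bagGraph, he', near_map_iff S S' hφ.1 hpar, ne_eq, e'.injective.eq_iff]

lemma bagCode_eq_of_iso {S : ParentTree B} {S' : ParentTree B'} (hS : S.Branching)
    (hS' : S'.Branching) {p : X → B} {p' : X' → B'} (hp : Function.Surjective p)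
    (hp' : Function.Surjective p') (Φ : S.bagGraph p ≃g S'.bagGraph p') {x : X}
    (hx : p x = S.root) (hx' : p' (Φ x) = S'.root) : S.bagCode p = S'.bagCode p' := by
  have hnear : ∀ y z, S'.Near (p' (Φ y)) (p' (Φ z)) ↔ S.Near (p y) (p z) := by
    intro y z
    rw [near_iff_bagGraph, near_iff_bagGraph, Φ.map_adj_iff, Φ.injective.eq_iff]
  have hfib : ∀ y z, p' (Φ y) = p' (Φ z) ↔ p y = p z := by
    intro y z
    constructor
    · intro e
      refine S.eq_of_near_iff hS fun b => ?_
      obtain ⟨t, rfl⟩ := hp b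
      rw [← hnear, ← hnear, e]
    · intro e
      refine S'.eq_of_near_iff hS' fun b => ?_
      obtain ⟨t, rfl⟩ := hp' b
      obtain ⟨t, rfl⟩ := Φ.surjective t
      rw [hnear, hnear, e]
  set φ : B → B' := fun b => p' (Φ (Function.surjInv hp b))
  have hφ : ∀ y, φ (p y) = p' (Φ y) := fun y => (hfib _ _).2 (Function.surjInv_eq hp _)
  have hbij : Function.Bijective φ := by
    constructor
    · intro b c h
      obtain ⟨y, rfl⟩ := hp b
      obtain ⟨z, rfl⟩ := hp c
      rwa [hφ, hφ, hfib] at h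
    · intro c
      obtain ⟨z, rfl⟩ := hp' c
      obtain ⟨y, rfl⟩ := Φ.surjective z
      exact ⟨p y, hφ y⟩
  have h0 : φ S.root = S'.root := by rw [← hx, hφ, hx']
  have hpar := map_par_of_near_iff S S' hbij.1 h0 fun b c => by
    obtain ⟨y, rfl⟩ := hp b
    obtain ⟨z, rfl⟩ := hp c
    rw [hφ, hφ, hnear]
  have hlabel : ∀ b, bagLabel p b = bagLabel p' (φ b) := by
    intro b
    unfold bagLabel
    congr 1
    refine Nat.card_congr (Φ.toEquiv.subtypeEquiv fun y => ?_)
    change p y = b ↔ p' (Φ y) = φ b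
    rw [← hφ, hbij.1.eq_iff]
  have := code_map_eq S S' hbij h0 hpar hlabel S.root
  rw [h0] at this
  exact this.symm

end ParentTree

lemma SimpleGraph.Reachable.mem_of_forall_adj {V : Type} {G : SimpleGraph V} {s : Set V}
    (hs : ∀ u ∈ s, ∀ v, G.Adj u v → v ∈ s) {u v : V} (h : G.Reachable u v) (hu : u ∈ s) :
    v ∈ s := by
  obtain ⟨p⟩ := h
  induction p with
  | nil => exact hu
  | cons h _ ih => exact ih (hs _ hu _ h)

lemma SimpleGraph.Connected.dist_le_three_iff {V : Type} {T : SimpleGraph V} (hT : T.Connected)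
    {a b qa qb : V} (hab : a ≠ b) (ha : ∀ u, T.Adj a u ↔ u = qa) (hb : ∀ u, T.Adj b u ↔ u = qb)
    (hqa : qa ≠ b) : T.dist a b ≤ 3 ↔ qa = qb ∨ T.Adj qa qb := by
  have h1 : T.Adj a qa := (ha _).2 rfl
  have h2 : T.Adj qb b := ((hb _).2 rfl).symm
  constructor
  · intro h
    obtain ⟨p, hp⟩ := hT.exists_walk_length_eq_dist a b
    rw [← hp] at h
    cases p with
    | nil => exact absurd rfl hab
    | cons e p =>
      obtain rfl := (ha _).1 e
      cases p with
      | nil => exact absurd rfl hqa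
      | cons e p =>
        cases p with
        | nil => exact Or.inl ((hb _).1 e.symm)
        | cons e' p =>
          cases p with
          | nil =>
            obtain rfl := (hb _).1 e'.symm
            exact Or.inr e
          | cons e'' p =>
            simp only [SimpleGraph.Walk.length_cons] at h
            omega
  · rintro (rfl | h)
    · exact (SimpleGraph.dist_le (.cons h1 (.cons h2 .nil))).trans (by simp)
    · exact (SimpleGraph.dist_le (.cons h1 (.cons h (.cons h2 .nil)))).trans (by simp)

lemma SimpleGraph.Connected.dist_map_le {V W : Type} {G : SimpleGraph V} {H : SimpleGraph W}
    (hG : G.Connected) (e : G →g H) (u v : V) : H.dist (e u) (e v) ≤ G.dist u v := by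
  obtain ⟨p, hp⟩ := hG.exists_walk_length_eq_dist u v
  rw [← hp, ← SimpleGraph.Walk.length_map e p]
  exact SimpleGraph.dist_le _

lemma isThreeLeafPower_of_isTree {V W : Type} [Finite W] {G : SimpleGraph V}
    {T : SimpleGraph W} (hT : T.IsTree) {f : V → W} (hf : Function.Injective f)
    (h1 : ∀ v, IsLeafVert T (f v)) (h2 : ∀ w, IsLeafVert T w → ∃ v, f v = w)
    (h3 : ∀ x y, x ≠ y → (G.Adj x y ↔ T.dist (f x) (f y) ≤ 3)) : IsThreeLeafPower G := by
  obtain ⟨m, ⟨e⟩⟩ := Finite.exists_equiv_fin W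
  set φ := SimpleGraph.Iso.map e T
  have hleaf : ∀ w, IsLeafVert (T.map e) (φ w) ↔ IsLeafVert T w := by
    intro w
    exact (φ.toEquiv.existsUnique_congr fun {u} => φ.map_adj_iff.symm).symm
  have hT' : (T.map e).IsTree := φ.isTree_iff.1 hT
  have hd : ∀ u v, (T.map e).dist (φ u) (φ v) = T.dist u v := by
    refine fun u v => le_antisymm (hT.connected.dist_map_le φ.toHom u v) ?_
    simpa using hT'.connected.dist_map_le φ.symm.toHom (φ u) (φ v)
  refine ⟨m, T.map e, hT', fun v => φ (f v),
    φ.injective.comp hf, fun v => (hleaf _).2 (h1 v), fun w hw => ?_, fun x y hxy => ?_⟩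
  · obtain ⟨w, rfl⟩ := φ.surjective w
    obtain ⟨v, rfl⟩ := h2 w ((hleaf w).1 hw)
    exact ⟨v, rfl⟩
  · rw [h3 x y hxy, hd]

namespace ParentTree

variable {B X : Type}

lemma connected_bagGraph (S : ParentTree B) {p : X → B} (hp : Function.Surjective p) :
    (S.bagGraph p).Connected := by
  obtain ⟨x₀, hx₀⟩ := hp S.root
  have h : ∀ b, ∀ x, p x = b → (S.bagGraph p).Reachable x x₀ := by
    refine S.induction_par (fun x hx => ?_) fun b hb ih x hx => ?_
    · by_cases e : x = x₀
      · rw [e]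
      · exact SimpleGraph.Adj.reachable ⟨e, Or.inl (hx.trans hx₀.symm)⟩
    · obtain ⟨y, hy⟩ := hp (S.par b)
      refine SimpleGraph.Reachable.trans (SimpleGraph.Adj.reachable ⟨?_, ?_⟩) (ih y hy)
      · rintro rfl
        exact S.par_ne hb (hy.symm.trans hx)
      · exact Or.inr (Or.inl (by rw [hx, hy]))
  exact { preconnected := fun u v => (h _ u rfl).trans (h _ v rfl).symm, nonempty := ⟨x₀⟩ }

/-- The rooted tree obtained by attaching a leaf `x` to `p x` for every `x`. -/
def attachLeaves (S : ParentTree B) (p : X → B) : ParentTree (B ⊕ X) where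
  root := Sum.inl S.root
  par := Sum.elim (fun b => Sum.inl (S.par b)) fun x => Sum.inl (p x)
  depth := Sum.elim S.depth fun x => S.depth (p x) + 1
  par_root := by simp [S.par_root]
  depth_root := S.depth_root
  depth_par := by
    rintro (b | x) h
    · exact S.depth_par b fun e => h (by rw [e])
    · rfl

lemma isThreeLeafPower_bagGraph [Finite B] [Finite X] {S : ParentTree B} (hS : S.Branching)
    {p : X → B} (hp : Function.Surjective p) : IsThreeLeafPower (S.bagGraph p) := by
  have hadj : ∀ x u, (S.attachLeaves p).graph.Adj (Sum.inr x) u ↔ u = Sum.inl (p x) := by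
    rintro x (b | y)
    · simp [graph, attachLeaves, eq_comm]
    · simp [graph, attachLeaves]
  refine isThreeLeafPower_of_isTree (S.attachLeaves p).graph_isTree (f := Sum.inr)
    Sum.inr_injective (fun x => ⟨_, (hadj x _).2 rfl, fun u hu => (hadj x u).1 hu⟩)
    (fun w hw => ?_) (fun x y hxy => ?_)
  · rcases w with b | x
    · exfalso
      by_cases hb : b = S.root
      · obtain ⟨c, c', hcc, hc, hc', h1, h2⟩ := hS
        have h : ∀ d, d ≠ S.root → S.par d = S.root →
            (S.attachLeaves p).graph.Adj (Sum.inl b) (Sum.inl d) := by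
          intro d hd h
          rw [hb]
          exact ⟨fun e => hd (Sum.inl_injective e).symm, Or.inr (by simp [attachLeaves, h])⟩
        exact hcc (Sum.inl_injective (hw.unique (h c hc h1) (h c' hc' h2)))
      · obtain ⟨x, rfl⟩ := hp b
        have h1 : (S.attachLeaves p).graph.Adj (Sum.inl (p x)) (Sum.inl (S.par (p x))) :=
          graph_adj_par (S.attachLeaves p) (b := Sum.inl (p x)) fun e => hb (Sum.inl_injective e)
        have h2 := hw.unique h1 ((hadj x _).2 rfl).symm
        simp at h2
    · exact ⟨x, rfl⟩
  · rw [(S.attachLeaves p).graph_connected.dist_le_three_iff (Sum.inr_injective.ne hxy) (hadj x)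
      (hadj y) (by simp), ← near_iff]
    simp [bagGraph, Near, hxy, attachLeaves]

lemma exists_bagGraph_eq [Fintype X] (hX : 2 < Fintype.card X) {G : SimpleGraph X}
    (hG : G.Connected) (h : IsThreeLeafPower G) (v : X) :
    ∃ (B : Type) (_ : Fintype B) (S : ParentTree B) (p : X → B),
      Function.Surjective p ∧ S.bagGraph p = G ∧ p v = S.root := by
  classical
  obtain ⟨m, T, hT, f, hf, hleaf, hleaf', hdist⟩ := h
  choose q hq hq' using hleaf
  have hadj : ∀ x u, T.Adj (f x) u ↔ u = q x := fun x u => ⟨hq' x u, fun e => e ▸ hq x⟩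
  have hqf : ∀ x, q x ∉ Set.range f := by
    rintro x ⟨y, hy⟩
    have hyx : q y = f x := ((hadj y _).1 (hy ▸ (hq x).symm)).symm
    have hmem : ∀ z, z = x ∨ z = y := by
      intro z
      have := (hT.connected.preconnected (f x) (f z)).mem_of_forall_adj (s := {f x, f y}) ?_
        (by simp)
      · simpa [hf.eq_iff] using this
      · rintro u (rfl | rfl) v huv
        · rw [hadj] at huv
          simp [huv, hy]
        · rw [hadj] at huv
          simp [huv, hyx]
    obtain ⟨a, b, c, hab, hac, hbc⟩ := Fintype.two_lt_card_iff.1 hX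
    rcases hmem a with rfl | rfl <;> rcases hmem b with rfl | rfl <;>
      rcases hmem c with rfl | rfl <;> contradiction
  obtain ⟨S₀, hr, rfl⟩ := exists_graph_eq hT (q v)
  have hfr : ∀ x, f x ≠ S₀.root := fun x e => hqf v ⟨x, e.trans hr⟩
  have hqpar : ∀ x, S₀.par (f x) = q x := fun x => (hadj x _).1 (S₀.graph_adj_par (hfr x))
  have hpar : ∀ w, S₀.par w ∉ Set.range f := by
    rintro w ⟨x, hx⟩
    by_cases hw : w = S₀.root
    · rw [hw, S₀.par_root] at hx
      exact hfr x hx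
    · have := (hadj x w).1 (hx ▸ (S₀.graph_adj_par hw).symm)
      rw [← hqpar, hx] at this
      exact S₀.par_par_ne hw this.symm
  let S : ParentTree {w // w ∉ Set.range f} :=
    { root := ⟨q v, hqf v⟩
      par := fun b => ⟨S₀.par b, hpar b⟩
      depth := fun b => S₀.depth b
      par_root := Subtype.ext (by simp only [← hr, S₀.par_root])
      depth_root := by simp only [← hr, S₀.depth_root]
      depth_par := fun b hb => S₀.depth_par b fun e => hb (Subtype.ext (e.trans hr)) }
  have hnear : ∀ x y, S.Near ⟨q x, hqf x⟩ ⟨q y, hqf y⟩ ↔ S₀.Near (q x) (q y) := by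
    intro x y
    simp only [Near, S, Subtype.mk.injEq]
  have hGadj : ∀ x y, x ≠ y → (G.Adj x y ↔ S₀.Near (q x) (q y)) := by
    intro x y hxy
    rw [hdist x y hxy, hT.connected.dist_le_three_iff (hf.ne hxy) (hadj x) (hadj y)
      (fun e => hqf x ⟨y, e.symm⟩), near_iff]
  refine ⟨_, inferInstance, S, fun x => ⟨q x, hqf x⟩, ?_, ?_, rfl⟩
  · rintro ⟨b, hb⟩
    by_cases hbr : b = q v
    · exact ⟨v, Subtype.ext hbr.symm⟩
    by_contra! hcon
    have hqb : ∀ x, q x ≠ b := fun x e => hcon x (Subtype.ext e)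
    rw [← hr] at hbr
    let Q : Fin m → Prop := fun u => ∃ k, S₀.par^[k + 1] u = b
    have hQr : ¬ Q S₀.root := by
      rintro ⟨k, hk⟩
      rw [Function.iterate_fixed S₀.par_root] at hk
      exact hbr hk.symm
    have hQ1 : ∀ u, S₀.par u = b → Q u := fun u hu => ⟨0, hu⟩
    have hQ2 : ∀ u, Q (S₀.par u) → Q u := by
      rintro u ⟨k, hk⟩
      exact ⟨k + 1, by rwa [Function.iterate_succ_apply]⟩
    have hQ3 : ∀ u, Q u → S₀.par u = b ∨ Q (S₀.par u) := by
      rintro u ⟨k, hk⟩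
      rw [Function.iterate_succ_apply] at hk
      cases k with
      | zero => exact Or.inl hk
      | succ k => exact Or.inr ⟨k, hk⟩
    obtain ⟨c, hc⟩ : ∃ c, Q c := by
      by_contra! hno
      refine hb (hleaf' b ⟨S₀.par b, S₀.graph_adj_par hbr, fun u hu => ?_⟩)
      rcases hu.2 with e | e
      · exact e.symm
      · exact absurd (hQ1 u e) (hno u)
    obtain ⟨u, hu, hmax⟩ := Finset.exists_max_image {u | Q u} S₀.depth ⟨c, by simpa using hc⟩
    simp only [Finset.mem_filter_univ] at hu hmax
    have hur : u ≠ S₀.root := fun e => hQr (e ▸ hu)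
    obtain ⟨x, rfl⟩ := hleaf' u ⟨S₀.par u, S₀.graph_adj_par hur, fun w hw => by
      rcases hw.2 with e | e
      · exact e.symm
      · have h1 := hmax w (hQ2 w (e ▸ hu))
        have h2 := S₀.depth_par w fun e' => hur (by rw [← e, e', S₀.par_root])
        rw [e] at h2
        omega⟩
    have hQq : ∀ y, Q (f y) → Q (q y) := fun y hy =>
      (hqpar y ▸ hQ3 _ hy).resolve_left (hqb y)
    have hqQ : ∀ y, Q (q y) → Q (f y) := fun y hy => hQ2 _ (by rwa [hqpar])
    refine hQr (hr ▸ hQq v ((hG.preconnected x v).mem_of_forall_adj (s := {y | Q (f y)}) ?_ hu))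
    intro y hy z hyz
    have hy' := hQq y hy
    refine hqQ z ?_
    rcases (hGadj y z hyz.ne).1 hyz with e | e | e
    · exact e ▸ hy'
    · exact (e ▸ hQ3 _ hy').resolve_left (hqb z)
    · exact hQ2 _ (e ▸ hy')
  · ext x y
    by_cases hxy : x = y
    · simp [hxy]
    · rw [hGadj x y hxy, ← hnear]
      simp [bagGraph, hxy]

end ParentTree

namespace ParentTree

open Finset

/-- The rooted tree whose root has the roots of the given rooted trees as children. -/
def graft {ι : Type} {B : ι → Type} [∀ i, DecidableEq (B i)] (S : ∀ i, ParentTree (B i)) :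
    ParentTree (Option (Σ i, B i)) where
  root := none
  par x := x.bind fun b => if b.2 = (S b.1).root then none else some ⟨b.1, (S b.1).par b.2⟩
  depth x := x.elim 0 fun b => (S b.1).depth b.2 + 1
  par_root := rfl
  depth_root := rfl
  depth_par := by
    rintro (_ | ⟨i, b⟩) h
    · exact absurd rfl h
    · by_cases hb : b = (S i).root
      · simp [hb, (S i).depth_root]
      · simp [hb, (S i).depth_par b hb]

lemma graft_par_some {ι : Type} {B : ι → Type} [∀ i, DecidableEq (B i)]
    (S : ∀ i, ParentTree (B i)) (i : ι) (b : B i) : (graft S).par (some ⟨i, b⟩) =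
      if b = (S i).root then none else some ⟨i, (S i).par b⟩ :=
  rfl

section Graft

variable {ι : Type} [Fintype ι] {B : ι → Type} [∀ i, DecidableEq (B i)] [∀ i, Fintype (B i)]
  (S : ∀ i, ParentTree (B i)) (w : ∀ i, B i → ℕ) (w₀ : ℕ)

lemma code_graft_some (i : ι) (b : B i) :
    (graft S).code (fun x => x.elim w₀ fun b => w b.1 b.2) (some ⟨i, b⟩) =
      (S i).code (w i) b := by
  induction b using (S i).induction_children with
  | h b ih =>
    have e : (graft S).children (some ⟨i, b⟩) = ((S i).children b).map
        ((Function.Embedding.sigmaMk i).trans Function.Embedding.some) := by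
      ext x
      rcases x with _ | ⟨j, c⟩
      · simp [graft]
      · rw [mem_children, graft_par_some, mem_map]
        constructor
        · rintro ⟨-, h⟩
          split_ifs at h with hc
          cases h
          exact ⟨c, (S _).mem_children.2 ⟨hc, rfl⟩, rfl⟩
        · rintro ⟨d, hd, h⟩
          cases h
          rw [mem_children] at hd
          simp [hd, graft]
    rw [code_eq, code_eq, e, map_val, Multiset.map_map]
    exact congrArg _ (Multiset.map_congr rfl fun c hc => ih c hc)

lemma code_graft_root :
    (graft S).code (fun x => x.elim w₀ fun b => w b.1 b.2) (graft S).root =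
      treeNode w₀ (univ.val.map fun i => (S i).code (w i) (S i).root) := by
  have e : (graft S).children (graft S).root = univ.map
      ⟨fun i => some ⟨i, (S i).root⟩,
        fun i j h => by simpa using congrArg (Option.map Sigma.fst) h⟩ := by
    ext x
    rcases x with _ | ⟨j, c⟩
    · simp [graft]
    · rw [mem_children, graft_par_some, mem_map]
      constructor
      · rintro ⟨-, h⟩
        split_ifs at h with hc
        · exact ⟨j, mem_univ _, hc ▸ rfl⟩
        · cases h
      · rintro ⟨i, -, h⟩
        cases h
        simp [graft]
  rw [code_eq, e, map_val, Multiset.map_map]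
  exact congrArg _ (Multiset.map_congr rfl fun i _ => code_graft_some S w w₀ i _)

end Graft

lemma exists_code_eq (t : ℕ) :
    ∃ (B : Type) (_ : Fintype B) (S : ParentTree B) (w : B → ℕ), S.code w S.root = t := by
  classical
  induction t using Nat.strong_induction_on with
  | _ t ih =>
    obtain ⟨w₀, m, rfl⟩ : ∃ w₀ m, treeNode w₀ m = t := ⟨_, _, treeNode_treeEquiv t⟩
    induction m using Quotient.inductionOn with
    | _ l =>
      have := fun i : Fin l.length => ih (l.get i) (lt_treeNode (by simp))
      choose B _ S w h using this
      refine ⟨_, inferInstance, graft S, _, (code_graft_root S w w₀).trans ?_⟩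
      simp only [h, Fin.univ_val_map]
      simp

lemma exists_bagCode_eq {n t : ℕ} (h : treeSize t = n) :
    ∃ (B : Type) (_ : Fintype B) (S : ParentTree B) (p : Fin n → B),
      Function.Surjective p ∧ S.bagCode p = t := by
  obtain ⟨B, _, S, w, rfl⟩ := exists_code_eq t
  rw [treeSize_code_root] at h
  have card : Fintype.card (Σ b, Fin (w b + 1)) = n := by simpa using h
  let e := Fintype.equivFinOfCardEq card
  refine ⟨B, ‹_›, S, fun x => (e.symm x).1, fun b => ⟨e ⟨b, 0⟩, by simp⟩, ?_⟩
  have hw : bagLabel (fun x => (e.symm x).1) = w := by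
    ext b
    have : Nat.card {x // (e.symm x).1 = b} = w b + 1 := by
      rw [Nat.card_congr ((e.symm.subtypeEquiv fun x => Iff.rfl).trans (Equiv.sigmaSubtype b)),
        Nat.card_eq_fintype_card, Fintype.card_fin]
    simp [bagLabel, this]
  rw [bagCode, hw]

lemma branching_of_code_eq {B : Type} [Fintype B] {S : ParentTree B} {w : B → ℕ} {w₀ : ℕ}
    {m : Multiset ℕ} (h : S.code w S.root = treeNode w₀ m) (hm : 1 < m.card) :
    S.Branching := by
  rw [code_eq] at h
  have hc := congrArg Multiset.card (treeNode_injective h).2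
  rw [Multiset.card_map] at hc
  obtain ⟨c, hc, c', hc', hne⟩ := one_lt_card.1 (show 1 < #(S.children S.root) by
    rw [Finset.card, hc]; exact hm)
  rw [mem_children] at hc hc'
  exact ⟨c, c', hne, hc.1, hc'.1, hc.2, hc'.2⟩

end ParentTree

open Finset ParentTree

lemma numRootedConn3LP_le {n : ℕ} (hn : 2 < n) : numRootedConn3LP n ≤ #(treesOfSize n) := by
  have ex : ∀ x : {x : SimpleGraph (Fin n) × Fin n // x.1.Connected ∧ IsThreeLeafPower x.1},
      ∃ t : treesOfSize n, ∃ (B : Type) (_ : Fintype B) (S : ParentTree B) (p : Fin n → B),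
        Function.Surjective p ∧ S.bagGraph p = x.1.1 ∧ p x.1.2 = S.root ∧ S.bagCode p = t := by
    rintro ⟨⟨G, v⟩, hG, h⟩
    obtain ⟨B, _, S, p, hp, h1, h2⟩ := exists_bagGraph_eq (by simpa using hn) hG h v
    exact ⟨⟨S.bagCode p, mem_treesOfSize.2 (by simp [treeSize_bagCode S hp])⟩, B, _, S, p, hp,
      h1, h2, rfl⟩
  choose g hg using ex
  rw [numRootedConn3LP, ← Fintype.card_coe, ← Nat.card_eq_fintype_card]
  refine Nat.card_le_card_of_injective (fun q => g q.out) fun q q' h => ?_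
  have h' : g q.out = g q'.out := h
  rw [← Quot.out_eq q, ← Quot.out_eq q']
  refine Quot.sound ?_
  obtain ⟨B, _, S, p, hp, h1, h2, h3⟩ := hg q.out
  obtain ⟨B', _, S', p', hp', h1', h2', h3'⟩ := hg q'.out
  rw [← h1, ← h1']
  exact exists_iso_of_bagCode_eq hp hp' (by rw [h3, h3', h']) h2 h2'

lemma card_treesOfSize_le_numRootedConn3LP (n : ℕ) :
    #(treesOfSize n) ≤ numRootedConn3LP (n + 2) := by
  have ex : ∀ t : treesOfSize n,
      ∃ x : {x : SimpleGraph (Fin (n + 2)) × Fin (n + 2) //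
        x.1.Connected ∧ IsThreeLeafPower x.1},
      ∃ (B : Type) (_ : Fintype B) (S : ParentTree B) (p : Fin (n + 2) → B),
        S.Branching ∧ Function.Surjective p ∧ S.bagGraph p = x.1.1 ∧ p x.1.2 = S.root ∧
        S.bagCode p = treeNode 0 {t.1, treeNode 0 0} := by
    rintro ⟨t, ht⟩
    rw [mem_treesOfSize] at ht
    obtain ⟨B, _, S, p, hp, h⟩ := exists_bagCode_eq (n := n + 2)
      (t := treeNode 0 {t, treeNode 0 0}) (by simp [treeSize_treeNode, ht]; omega)
    have hS : S.Branching := branching_of_code_eq h (by simp)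
    obtain ⟨v, hv⟩ := hp S.root
    exact ⟨⟨⟨S.bagGraph p, v⟩, S.connected_bagGraph hp, isThreeLeafPower_bagGraph hS hp⟩,
      B, _, S, p, hS, hp, rfl, hv, h⟩
  choose g hg using ex
  have hfin : Finite {x : SimpleGraph (Fin (n + 2)) × Fin (n + 2) //
      x.1.Connected ∧ IsThreeLeafPower x.1} := inferInstance
  rw [numRootedConn3LP, ← Fintype.card_coe, ← Nat.card_eq_fintype_card]
  refine Nat.card_le_card_of_injective (fun t => Quot.mk _ (g t)) fun t t' h => ?_
  have heq : Equivalence fun (p q : {x : SimpleGraph (Fin (n + 2)) × Fin (n + 2) //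
      x.1.Connected ∧ IsThreeLeafPower x.1}) => ∃ φ : p.val.1 ≃g q.val.1, φ p.val.2 = q.val.2 :=
    { refl := fun p => ⟨SimpleGraph.Iso.refl, rfl⟩
      symm := fun ⟨φ, hφ⟩ => ⟨φ.symm, by simp [← hφ]⟩
      trans := fun ⟨φ, hφ⟩ ⟨ψ, hψ⟩ => ⟨ψ.comp φ, by simp [hφ, hψ]⟩ }
  obtain ⟨Φ, hΦ⟩ := (heq.quot_mk_eq_iff _ _).1 h
  obtain ⟨B, _, S, p, hS, hp, h1, h2, h3⟩ := hg t
  obtain ⟨B', _, S', p', hS', hp', h1', h2', h3'⟩ := hg t'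
  generalize (g t).1 = x at *
  generalize (g t').1 = x' at *
  obtain ⟨G, v⟩ := x
  obtain ⟨G', v'⟩ := x'
  subst h1 h1'
  have := bagCode_eq_of_iso hS hS' hp hp' Φ h2 (hΦ ▸ h2')
  rw [h3, h3'] at this
  exact Subtype.ext ((Multiset.cons_inj_left _).1 (treeNode_injective this).2)

lemma exists_pow_mul_sq_le {a b : ℝ} (ha : 0 < a) (hab : a < b) :
    ∃ C : ℝ, 0 < C ∧ ∀ n : ℕ, a ^ n * (n : ℝ) ^ 2 ≤ C * b ^ n := by
  have hb : 0 < b := ha.trans hab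
  have h := tendsto_pow_const_div_const_pow_of_one_lt 2 ((one_lt_div ha).2 hab)
  obtain ⟨C, hC⟩ := h.bddAbove_range
  refine ⟨max C 1, by positivity, fun n => ?_⟩
  have h1 : (n : ℝ) ^ 2 / (b / a) ^ n ≤ max C 1 := (hC ⟨n, rfl⟩).trans (le_max_left _ _)
  rw [div_pow, div_div_eq_mul_div, div_le_iff₀ (by positivity)] at h1
  linarith

theorem numRootedConn3LP_asymptotics :
    ∃ (c C : ℝ), 0 < c ∧ 0 < C ∧ ∃ N : ℕ, ∀ n : ℕ, N ≤ n →
      c * 3.848 ^ n * (n : ℝ) ^ (-(3 : ℝ) / 2) ≤ (numRootedConn3LP n : ℝ) ∧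
      (numRootedConn3LP n : ℝ) ≤ C * 3.849 ^ n * (n : ℝ) ^ (-(3 : ℝ) / 2) := by
  obtain ⟨c, hc, hlow⟩ := isEulerPair_trees.exists_le_F
  obtain ⟨C, hC, hup⟩ := exists_pow_mul_sq_le (a := 3.84899) (b := 3.849)
    (by norm_num) (by norm_num)
  refine ⟨c / 3.84801 ^ 2, C, by positivity, hC, 3, fun n hn => ?_⟩
  have hn1 : (1 : ℝ) ≤ n := by exact_mod_cast (by omega : 1 ≤ n)
  constructor
  · obtain ⟨k, rfl⟩ : ∃ k, n = k + 2 := ⟨n - 2, by omega⟩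
    have h1 := hlow k (by omega)
    have h2 : (treesOfSize k).card ≤ (numRootedConn3LP (k + 2) : ℝ) := by
      exact_mod_cast card_treesOfSize_le_numRootedConn3LP k
    have h3 : ((k + 2 : ℕ) : ℝ) ^ (-(3 : ℝ) / 2) ≤ ((k + 2 : ℕ) : ℝ)⁻¹ := by
      rw [← Real.rpow_neg_one]
      exact Real.rpow_le_rpow_of_exponent_le hn1 (by norm_num)
    have h4 : (3.848 : ℝ) ^ (k + 2) ≤ 3.84801 ^ (k + 2) :=
      pow_le_pow_left₀ (by norm_num) (by norm_num) _
    calc c / 3.84801 ^ 2 * 3.848 ^ (k + 2) * ((k + 2 : ℕ) : ℝ) ^ (-(3 : ℝ) / 2)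
        ≤ c / 3.84801 ^ 2 * 3.84801 ^ (k + 2) * ((k + 2 : ℕ) : ℝ)⁻¹ := by gcongr
      _ = c * 3.84801 ^ k * ((k + 2 : ℕ) : ℝ)⁻¹ := by
        rw [pow_add]
        field_simp
      _ ≤ (k * (treesOfSize k).card) * ((k + 2 : ℕ) : ℝ)⁻¹ := by gcongr
      _ ≤ (treesOfSize k).card := by
        rw [← div_eq_mul_inv, div_le_iff₀ (by positivity)]
        push_cast
        nlinarith [Nat.cast_nonneg (α := ℝ) (treesOfSize k).card]
      _ ≤ _ := h2
  · have h1 : (numRootedConn3LP n : ℝ) ≤ (treesOfSize n).card := by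
      exact_mod_cast numRootedConn3LP_le hn
    have h2 : ((n : ℝ) ^ 2)⁻¹ ≤ (n : ℝ) ^ (-(3 : ℝ) / 2) := by
      rw [← Real.rpow_natCast, ← Real.rpow_neg (by positivity)]
      exact Real.rpow_le_rpow_of_exponent_le hn1 (by norm_num)
    calc (numRootedConn3LP n : ℝ) ≤ 3.84899 ^ n := h1.trans (isEulerPair_trees.F_le n)
      _ ≤ C * 3.849 ^ n * ((n : ℝ) ^ 2)⁻¹ := by
        rw [← div_eq_mul_inv, le_div_iff₀ (by positivity)]
        exact hup n
      _ ≤ _ := by gcongr
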